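/- arXiv:1003.3578 — 2 statements merged into one kernel-verified Lean document; each statement's English description precedes it below -/
import Mathlib

section
/- Let N ≥ 1 and let f ∈ C¹(ℝ) satisfy conditions (2) and (3). Let u₁, u₂ : (r₀,1) → ℝ be two strictly increasing C² solutions of u'' + ((N−1)/r) u' = f(u) with u_i(r) → +∞ as r → 1⁻. Set v_i = u_i' and g_i = −v_i²/2 + F(u_i) for i = 1,2, regarded as functions of the variable u via the changes of variables u = u_i(r). Then the difference g₁ − g₂ is bounded on a neighborhood of +∞. -/
open MeasureTheory Filter Metric Set Topology

lemma mono_of_hd {h h' : ℝ → ℝ} {U : ℝ} (hd : ∀ t ≥ U, HasDerivAt h (h' t) t)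
    (hp : ∀ t ≥ U, 0 ≤ h' t) {s t : ℝ} (hs : U ≤ s) (hst : s ≤ t) : h s ≤ h t := by
  have : MonotoneOn h (Ici U) := by
    apply monotoneOn_of_deriv_nonneg (convex_Ici U)
    · exact fun x hx => (hd x hx).continuousAt.continuousWithinAt
    · intro x hx
      rw [interior_Ici] at hx
      exact (hd x (le_of_lt hx)).differentiableAt.differentiableWithinAt
    · intro x hx
      rw [interior_Ici] at hx
      rw [(hd x (le_of_lt hx)).deriv]
      exact hp x (le_of_lt hx)
  exact this hs (le_trans hs hst) hst

lemma abs_le_of_hd {h h' m m' : ℝ → ℝ} {U : ℝ} (hd : ∀ t ≥ U, HasDerivAt h (h' t) t)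
    (md : ∀ t ≥ U, HasDerivAt m (m' t) t)
    (hp : ∀ t ≥ U, |h' t| ≤ m' t) {s t : ℝ} (hs : U ≤ s) (hst : s ≤ t) :
    |h t - h s| ≤ m t - m s := by
  have h1 := mono_of_hd (fun x hx => (md x hx).sub (hd x hx))
    (fun x hx => by have := (abs_le.1 (hp x hx)).2; linarith) hs hst
  have h2 := mono_of_hd (fun x hx => (md x hx).add (hd x hx))
    (fun x hx => by have := (abs_le.1 (hp x hx)).1; linarith) hs hst
  simp only [Pi.sub_apply, Pi.add_apply] at h1 h2
  rw [abs_le]; constructor <;> linarith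

/-- The tail integral of `1/√F`. -/
lemma exists_eps {F : ℝ → ℝ} (hFc : Continuous F) {T : ℝ} (hpos : ∀ t ≥ T, 0 < F t)
    (hint : IntegrableOn (fun t => (Real.sqrt (F t))⁻¹) (Ici T)) :
    ∃ ε : ℝ → ℝ, (∀ t > T, HasDerivAt ε (-(Real.sqrt (F t))⁻¹) t) ∧
      (∀ t > T, 0 ≤ ε t) ∧ Tendsto ε atTop (𝓝 0) := by
  have hm : Measurable (fun t => (Real.sqrt (F t))⁻¹) := by fun_prop
  have hint' : IntegrableOn (fun t => (Real.sqrt (F t))⁻¹) (Ioi T) :=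
    hint.mono_set Ioi_subset_Ici_self
  let ε : ℝ → ℝ := fun t => (∫ x in Ioi T, (Real.sqrt (F x))⁻¹) - ∫ x in T..t, (Real.sqrt (F x))⁻¹
  have hd : ∀ t > T, HasDerivAt ε (-(Real.sqrt (F t))⁻¹) t := by
    intro t ht
    have := intervalIntegral.integral_hasDerivAt_right (a := T) (b := t)
      (f := fun t => (Real.sqrt (F t))⁻¹) ?_ ?_ ?_
    · simpa using this.const_sub (∫ x in Ioi T, (Real.sqrt (F x))⁻¹)
    · rw [intervalIntegrable_iff_integrableOn_Ioc_of_le ht.le]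
      exact hint'.mono_set Ioc_subset_Ioi_self
    · exact hm.stronglyMeasurable.stronglyMeasurableAtFilter
    · have h0 : Real.sqrt (F t) ≠ 0 := (Real.sqrt_pos.2 (hpos t ht.le)).ne'
      exact (hFc.sqrt.continuousAt).inv₀ h0
  have ht0 : Tendsto ε atTop (𝓝 0) := by
    have := (intervalIntegral_tendsto_integral_Ioi T hint' tendsto_id).const_sub
      (∫ x in Ioi T, (Real.sqrt (F x))⁻¹)
    simpa [ε] using this
  refine ⟨ε, hd, ?_, ht0⟩
  intro t ht
  refine le_of_tendsto ht0 ?_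
  filter_upwards [eventually_ge_atTop t] with s hs
  have := mono_of_hd (U := t) (fun x hx => (hd x (lt_of_lt_of_le ht hx)).neg)
    (fun x _ => by simp [Real.sqrt_nonneg]) le_rfl hs
  simp only [Pi.neg_apply] at this
  linarith

lemma tendsto_F {F : ℝ → ℝ} {T U : ℝ} (hpos : ∀ t ≥ T, 0 < F t)
    (hint : IntegrableOn (fun t => (Real.sqrt (F t))⁻¹) (Ici T))
    (hmono : ∀ s t, U ≤ s → s ≤ t → F s ≤ F t) : Tendsto F atTop atTop := by
  rw [Filter.tendsto_atTop]
  intro M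
  by_contra hcon
  have hb : ∀ t ≥ U, F t ≤ M := by
    intro t ht
    by_contra! h
    apply hcon
    filter_upwards [eventually_ge_atTop t] with s hs
    exact h.le.trans (hmono t s ht hs)
  set V := max T U
  have h1 : IntegrableOn (fun t => (Real.sqrt (F t))⁻¹) (Ici V) :=
    hint.mono_set (Ici_subset_Ici.2 (le_max_left _ _))
  have hMpos : 0 < M := (hpos V (le_max_left _ _)).trans_le (hb V (le_max_right _ _))
  have h2 : IntegrableOn (fun _ : ℝ => (Real.sqrt M)⁻¹) (Ici V) := by
    refine Integrable.mono' h1 aestronglyMeasurable_const ?_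
    refine (ae_restrict_iff' measurableSet_Ici).2 (Eventually.of_forall fun t ht => ?_)
    have ht' : V ≤ t := ht
    have hFt := hpos t ((le_max_left _ _).trans ht')
    rw [Real.norm_of_nonneg (by positivity)]
    have := Real.sqrt_pos.2 hFt
    have := Real.sqrt_le_sqrt (hb t ((le_max_right _ _).trans ht'))
    gcongr
  rw [integrableOn_const_iff (by simp)] at h2
  have := Real.sqrt_pos.2 hMpos
  simp [this.ne'] at h2

/-- `√F ≤ v ≤ K √F` eventually. -/
lemma v_bounds {F f ε v ρ g : ℝ → ℝ} {U n : ℝ} (hn : 0 ≤ n)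
    (hF : ∀ t ≥ U, HasDerivAt F (f t) t) (hf : ∀ t ≥ U, 0 ≤ f t) (hpos : ∀ t ≥ U, 0 < F t)
    (hFt : Tendsto F atTop atTop)
    (hε : ∀ t ≥ U, HasDerivAt ε (-(Real.sqrt (F t))⁻¹) t) (hε0 : ∀ t ≥ U, 0 ≤ ε t)
    (hεt : Tendsto ε atTop (𝓝 0))
    (hg : ∀ t ≥ U, g t = F t - v t ^ 2 / 2)
    (hgd : ∀ t ≥ U, HasDerivAt g (n * (v t / ρ t)) t)
    (hv : ∀ t ≥ U, 0 < v t) (hρ : ∀ t ≥ U, 1 / 2 ≤ ρ t) :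
    ∃ K ≥ 0, ∀ᶠ t in atTop, Real.sqrt (F t) ≤ v t ∧ v t ≤ K * Real.sqrt (F t) := by
  set k := 2 + 2 * |g U| / F U with hk
  have hFU := hpos U le_rfl
  have hk0 : 0 ≤ k := by positivity
  have hup : ∀ t ≥ U, v t ≤ Real.sqrt k * Real.sqrt (F t) := by
    intro t ht
    rw [← Real.sqrt_mul hk0]
    apply Real.le_sqrt_of_sq_le
    have h1 : g U ≤ g t := mono_of_hd hgd (fun x hx => by
      have := hv x hx; have := hρ x hx
      have : 0 < ρ x := by linarith
      positivity) le_rfl ht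
    have h2 : F U ≤ F t := mono_of_hd hF hf le_rfl ht
    have h3 := hg t ht
    have h4 : |g U| ≤ |g U| / F U * F t := by
      rw [div_mul_eq_mul_div, le_div_iff₀ hFU]
      gcongr
    have h5 := neg_abs_le (g U)
    have h6 : k * F t = 2 * F t + 2 * (|g U| / F U * F t) := by rw [hk]; ring
    rw [h6]; linarith
  set C := 2 * n * Real.sqrt k with hC
  have hC0 : 0 ≤ C := by positivity
  have hgd' : ∀ t ≥ U, n * (v t / ρ t) ≤ C * Real.sqrt (F t) := by
    intro t ht
    have h1 := hρ t ht
    have h2 := hv t ht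
    have h3 : v t / ρ t ≤ 2 * v t := by
      rw [div_le_iff₀ (by linarith)]; nlinarith
    have h4 : v t / ρ t ≤ 2 * (Real.sqrt k * Real.sqrt (F t)) := by linarith [hup t ht]
    calc _ ≤ n * (2 * (Real.sqrt k * Real.sqrt (F t))) := by gcongr
      _ = _ := by rw [hC]; ring
  have hsmall : ∀ᶠ t in atTop, C * ε t < 1 / 4 := by
    have : Tendsto (fun t => C * ε t) atTop (𝓝 (C * 0)) := hεt.const_mul C
    rw [mul_zero] at this
    exact this.eventually (gt_mem_nhds (by norm_num))
  obtain ⟨U0, hU0, hU0U⟩ := (hsmall.and (eventually_ge_atTop U)).exists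
  refine ⟨Real.sqrt k, Real.sqrt_nonneg _, ?_⟩
  filter_upwards [eventually_ge_atTop U0, hFt.eventually_ge_atTop (4 * g U0)] with t ht hbig
  have htU := hU0U.trans ht
  refine ⟨?_, hup t htU⟩
  apply Real.sqrt_le_iff.2 ⟨(hv t htU).le, ?_⟩
  have key : ∀ x ≥ U0, ε x ≤ ε U0 := fun x hx => by
    have := mono_of_hd (fun x hx => (hε x hx).neg) (fun x _ => by simp [Real.sqrt_nonneg]) hU0U hx
    simpa using this
  have h1 := mono_of_hd (U := U0)
    (fun x hx => ((((hε x (hU0U.trans hx)).const_sub (ε U0)).mul (hF x (hU0U.trans hx))).const_mul C).sub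
      (hgd x (hU0U.trans hx))) (fun x hx => by
        have hxU := hU0U.trans hx
        have h1 := hgd' x hxU
        have h2 := hf x hxU
        have h3 := key x hx
        have h4 : (Real.sqrt (F x))⁻¹ * F x = Real.sqrt (F x) := by
          have h5 := Real.sqrt_pos.2 (hpos x hxU)
          have h6 := Real.mul_self_sqrt (hpos x hxU).le
          nth_rewrite 2 [← h6]
          field_simp
        have h5 : 0 ≤ C * ((ε U0 - ε x) * f x) := by
          have : 0 ≤ ε U0 - ε x := by linarith
          positivity
        rw [neg_neg, h4]
        linarith) le_rfl ht
  simp only [Pi.sub_apply, Pi.mul_apply, sub_self, zero_mul, mul_zero] at h1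
  have h2 := hg t htU
  have h3 := hpos t htU
  have h4 := hε0 t htU
  have h5 : 0 ≤ C * ε t * F t := by positivity
  have h6 : C * ε U0 * F t ≤ 1 / 4 * F t := by gcongr
  nlinarith

lemma contraction {F f ε G G' D D' : ℝ → ℝ} {U C : ℝ} (hC : 0 ≤ C) (hFc : Continuous F)
    (hF : ∀ t ≥ U, HasDerivAt F (f t) t) (hf : ∀ t ≥ U, 0 ≤ f t) (hpos : ∀ t ≥ U, 0 < F t)
    (hε : ∀ t ≥ U, HasDerivAt ε (-(Real.sqrt (F t))⁻¹) t) (hε0 : ∀ t ≥ U, 0 ≤ ε t)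
    (hεt : Tendsto ε atTop (𝓝 0))
    (hG : ∀ t ≥ U, HasDerivAt G (G' t) t) (hD : ∀ t ≥ U, HasDerivAt D (D' t) t)
    (hG1 : ∀ t ≥ U, |G' t| ≤ C * Real.sqrt (F t))
    (hG2 : ∀ t ≥ U, |G' t| ≤ C * (|G t| * (Real.sqrt (F t))⁻¹ + Real.sqrt (F t) * |D t|))
    (hD1 : ∀ t ≥ U, |D' t| ≤ C * (|G t| * (Real.sqrt (F t))⁻¹ * (F t)⁻¹))
    (hDt : Tendsto D atTop (𝓝 0)) :
    ∃ K, ∀ᶠ t in atTop, |G t| ≤ K := by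
  have hsmall : ∀ᶠ t in atTop, C * ε t < 1 / 4 := by
    have : Tendsto (fun t => C * ε t) atTop (𝓝 (C * 0)) := hεt.const_mul C
    rw [mul_zero] at this
    exact this.eventually (gt_mem_nhds (by norm_num))
  obtain ⟨V, hV, hVU⟩ := (hsmall.and (eventually_ge_atTop U)).exists
  have key : ∀ x ≥ V, ε x ≤ ε V := fun x hx => by
    have := mono_of_hd (fun x hx => (hε x hx).neg) (fun x _ => by simp [Real.sqrt_nonneg]) hVU hx
    simpa using this
  set q : ℝ → ℝ := fun t => Real.sqrt (F t) with hq
  have hqc : Continuous q := hFc.sqrt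
  have hq0 : ∀ t ≥ V, 0 < q t := fun t ht => Real.sqrt_pos.2 (hpos t (hVU.trans ht))
  have hqq : ∀ t ≥ V, F t = q t * q t := fun t ht =>
    (Real.mul_self_sqrt (hpos t (hVU.trans ht)).le).symm
  obtain ⟨Φ, hΦ, hΦV⟩ : ∃ Φ : ℝ → ℝ, (∀ t, HasDerivAt Φ (q t) t) ∧ Φ V = 0 :=
    ⟨fun t => ∫ x in V..t, q x, fun t => hqc.integral_hasStrictDerivAt V t |>.hasDerivAt, by simp⟩
  have hΦ0 : ∀ t ≥ V, 0 ≤ Φ t := fun t ht => by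
    rw [← hΦV]
    exact mono_of_hd (fun x _ => hΦ x) (fun x hx => (hq0 x hx).le) le_rfl ht
  set e := ε V with he
  have he0 : 0 ≤ e := hε0 V hVU
  -- one step
  have step : ∀ A B : ℝ, 0 ≤ A → 0 ≤ B → (∀ t ≥ V, |G t| ≤ A + B * Φ t) →
      ∀ t ≥ V, |G t| ≤ |G V| + (A + B * Φ t) / 2 := by
    intro A B hA hB hAB
    have hDb : ∀ s ≥ V, |D s| ≤ C * ((A + B * Φ s) * ε s / F s + B * (ε s ^ 2 / 2)) := by
      intro s hs
      have hXd : ∀ t ≥ V, HasDerivAt (fun t => -(C * ((A + B * Φ t) * ε t / F t + B * (ε t ^ 2 / 2))))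
          (-(C * (((B * q t * ε t + (A + B * Φ t) * (-(q t)⁻¹)) * F t - (A + B * Φ t) * ε t * f t)
            / F t ^ 2 + B * ((2 * ε t * (-(q t)⁻¹)) / 2)))) t := by
        intro t ht
        have htU := hVU.trans ht
        have h1 := (((hΦ t).const_mul B).const_add A).mul (hε t htU)
        have h2 := h1.div (hF t htU) (hpos t htU).ne'
        have h3 := (((hε t htU).pow 2).div_const 2).const_mul B
        have h4 := ((h2.add h3).const_mul C).neg
        refine h4.congr_deriv ?_
        simp [hq]
      have hle : ∀ t ≥ V, |D' t| ≤ -(C * (((B * q t * ε t + (A + B * Φ t) * (-(q t)⁻¹)) * F t -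
          (A + B * Φ t) * ε t * f t) / F t ^ 2 + B * ((2 * ε t * (-(q t)⁻¹)) / 2))) := by
        intro t ht
        have htU := hVU.trans ht
        have hFp := hpos t htU
        have hqp := hq0 t ht
        have hfp := hf t htU
        have hεp := hε0 t htU
        have hΦp := hΦ0 t ht
        refine (hD1 t htU).trans ?_
        have e1 : -(C * (((B * q t * ε t + (A + B * Φ t) * (-(q t)⁻¹)) * F t -
          (A + B * Φ t) * ε t * f t) / F t ^ 2 + B * ((2 * ε t * (-(q t)⁻¹)) / 2))) =
          C * ((A + B * Φ t) * (q t)⁻¹ * (F t)⁻¹ + (A + B * Φ t) * ε t * f t / F t ^ 2) := by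
          rw [hqq t ht]; field_simp; ring
        rw [e1]
        have h1 := hAB t ht
        have h2 : 0 ≤ (A + B * Φ t) * ε t * f t / F t ^ 2 := by positivity
        have h3 : |G t| * (q t)⁻¹ * (F t)⁻¹ ≤ (A + B * Φ t) * (q t)⁻¹ * (F t)⁻¹ := by gcongr
        gcongr
        linarith
      have hlim : Tendsto (fun t => |D t - D s|) atTop (𝓝 |0 - D s|) := (hDt.sub_const _).abs
      rw [zero_sub, abs_neg] at hlim
      refine le_of_tendsto hlim ?_
      filter_upwards [eventually_ge_atTop s] with t ht
      have h1 := abs_le_of_hd (fun x hx => hD x (hVU.trans hx)) hXd hle hs ht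
      have hX0 : 0 ≤ C * ((A + B * Φ t) * ε t / F t + B * (ε t ^ 2 / 2)) := by
        have htV := hs.trans ht
        have htU := hVU.trans htV
        have hFp := hpos t htU
        have hεp := hε0 t htU
        have hΦp := hΦ0 t htV
        positivity
      linarith
    intro t ht
    have hMd : ∀ t ≥ V, HasDerivAt (fun t => C * ((1 + C * e) * ((A + B * Φ t) * (e - ε t)) +
          B * (C * e ^ 2 / 2) * Φ t))
        (C * ((1 + C * e) * (B * q t * (e - ε t) + (A + B * Φ t) * (q t)⁻¹) +
          B * (C * e ^ 2 / 2) * q t)) t := by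
      intro t ht
      have htU := hVU.trans ht
      have h1 := (((hΦ t).const_mul B).const_add A).mul ((hε t htU).const_sub e)
      have h2 := ((h1.const_mul (1 + C * e)).add ((hΦ t).const_mul (B * (C * e ^ 2 / 2)))).const_mul C
      refine h2.congr_deriv ?_
      simp [hq]
    have hle : ∀ t ≥ V, |G' t| ≤ C * ((1 + C * e) * (B * q t * (e - ε t) + (A + B * Φ t) * (q t)⁻¹) +
          B * (C * e ^ 2 / 2) * q t) := by
      intro t ht
      have htU := hVU.trans ht
      have hFp := hpos t htU
      have hqp := hq0 t ht
      have hεp := hε0 t htU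
      have hΦp := hΦ0 t ht
      have hk := key t ht
      have h1 := hAB t ht
      have h2 := hDb t ht
      refine (hG2 t htU).trans ?_
      apply mul_le_mul_of_nonneg_left _ hC
      change |G t| * (q t)⁻¹ + q t * |D t| ≤ _
      calc |G t| * (q t)⁻¹ + q t * |D t| ≤ (A + B * Φ t) * (q t)⁻¹ +
            q t * (C * ((A + B * Φ t) * ε t / F t + B * (ε t ^ 2 / 2))) := by gcongr
        _ = (A + B * Φ t) * (q t)⁻¹ + (C * ((A + B * Φ t) * (q t)⁻¹ * ε t) +
            B * (C * ε t ^ 2 / 2) * q t) := by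
            rw [hqq t ht]; field_simp
        _ ≤ (A + B * Φ t) * (q t)⁻¹ + (C * ((A + B * Φ t) * (q t)⁻¹ * e) +
            B * (C * e ^ 2 / 2) * q t) := by gcongr
        _ = (1 + C * e) * ((A + B * Φ t) * (q t)⁻¹) + B * (C * e ^ 2 / 2) * q t := by ring
        _ ≤ _ := by
            have : 0 ≤ B * q t * (e - ε t) := by
              have : 0 ≤ e - ε t := by linarith
              positivity
            gcongr
            linarith
    have h1 := abs_le_of_hd (fun x hx => hG x (hVU.trans hx)) hMd hle le_rfl ht
    have hεp := hε0 t (hVU.trans ht)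
    have hΦp := hΦ0 t ht
    have hk := key t ht
    have h2 : |G t| ≤ |G V| + |G t - G V| := by
      have := abs_add_le (G V) (G t - G V)
      simpa using this
    have hCe : 0 ≤ C * e := by positivity
    have h3 : C * ((1 + C * e) * ((A + B * Φ t) * (e - ε t)) + B * (C * e ^ 2 / 2) * Φ t) ≤
        (A + B * Φ t) / 2 := by
      calc _ ≤ C * ((1 + C * e) * ((A + B * Φ t) * e) + B * (C * e ^ 2 / 2) * Φ t) := by
            gcongr; linarith
        _ = (C * e) * (1 + C * e) * (A + B * Φ t) + (C * e) ^ 2 / 2 * (B * Φ t) := by ring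
        _ ≤ (1/4) * (1 + 1/4) * (A + B * Φ t) + (1/4) ^ 2 / 2 * (B * Φ t) := by gcongr
        _ ≤ _ := by
            have : 0 ≤ B * Φ t := by positivity
            linarith
    have h4 : C * ((1 + C * e) * ((A + B * Φ V) * (e - ε V)) + B * (C * e ^ 2 / 2) * Φ V) = 0 := by
      rw [hΦV, ← he]; ring
    simp only [h4] at h1
    linarith
  have hall : ∀ k : ℕ, ∀ t ≥ V, |G t| ≤ 2 * |G V| + C / 2 ^ k * Φ t := by
    intro k
    induction k with
    | zero =>
      intro t ht
      have h1 := abs_le_of_hd (fun x hx => hG x (hVU.trans hx)) (fun x _ => (hΦ x).const_mul C)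
        (fun x hx => hG1 x (hVU.trans hx)) le_rfl ht
      have h2 : |G t| ≤ |G V| + |G t - G V| := by
        have := abs_add_le (G V) (G t - G V)
        simpa using this
      rw [hΦV] at h1
      have := abs_nonneg (G V)
      simp
      linarith
    | succ k ih =>
      intro t ht
      have := step (2 * |G V|) (C / 2 ^ k) (by positivity) (by positivity) ih t ht
      refine this.trans (le_of_eq ?_)
      rw [pow_succ]; field_simp; ring
  refine ⟨2 * |G V|, ?_⟩
  filter_upwards [eventually_ge_atTop V] with t ht
  have hlim : Tendsto (fun k : ℕ => 2 * |G V| + C / 2 ^ k * Φ t) atTop (𝓝 (2 * |G V| + 0 * Φ t)) := by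
    refine ((Tendsto.div_atTop tendsto_const_nhds ?_).mul_const _).const_add _
    exact tendsto_pow_atTop_atTop_of_one_lt (by norm_num)
  rw [zero_mul, add_zero] at hlim
  exact ge_of_tendsto' hlim (fun k => hall k t ht)

lemma change_var {m : ℕ} {f F u d ρ : ℝ → ℝ} {a r₀ : ℝ} (hF : ∀ t, HasDerivAt F (f t) t)
    (hf0 : ∀ t > a, 0 ≤ f t) (hr₀ : r₀ ∈ Ico (0 : ℝ) 1)
    (hmono : StrictMonoOn u (Ioo r₀ 1))
    (hd : ∀ r ∈ Ioo r₀ (1 : ℝ), HasDerivAt u (d r) r)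
    (heq : ∀ r ∈ Ioo r₀ (1 : ℝ), HasDerivAt d (f (u r) - (m : ℝ) / r * d r) r)
    (hblow : Tendsto u (𝓝[<] (1 : ℝ)) atTop)
    (hρ : ∀ r ∈ Ioo r₀ (1 : ℝ), ρ (u r) = r) :
    ∃ U, (∀ t ≥ U, HasDerivAt ρ (d (ρ t))⁻¹ t) ∧ (∀ t ≥ U, 0 < d (ρ t)) ∧
      (∀ t ≥ U, 1 / 2 ≤ ρ t) ∧
      (∀ t ≥ U, HasDerivAt (fun t => F t - d (ρ t) ^ 2 / 2) (m * (d (ρ t) / ρ t)) t) ∧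
      Tendsto ρ atTop (𝓝 1) := by
  obtain ⟨hr0, hr1⟩ := hr₀
  have hnear : ∀ M : ℝ, ∀ c < 1, ∃ r, r₀ < r ∧ c < r ∧ r < 1 ∧ M < u r := by
    intro M c hc
    have h1 : ∀ᶠ r in 𝓝[<] (1 : ℝ), M < u r := hblow.eventually_gt_atTop M
    have h2 : ∀ᶠ r in 𝓝[<] (1 : ℝ), r ∈ Ioo (max r₀ c) 1 := Ioo_mem_nhdsLT (max_lt hr1 hc)
    obtain ⟨r, h3, h4⟩ := (h1.and h2).exists
    exact ⟨r, (le_max_left _ _).trans_lt h4.1, (le_max_right _ _).trans_lt h4.1, h4.2, h3⟩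
  obtain ⟨b, hb0, hbh, hb1, hba⟩ := hnear a (1 / 2) (by norm_num)
  obtain ⟨b', hb0', hbb', hb1', -⟩ := hnear a b hb1
  obtain ⟨c, hc, hdc⟩ := exists_hasDerivAt_eq_slope u d hbb'
    (fun x hx => (hd x ⟨hb0.trans_le hx.1, hx.2.trans_lt hb1'⟩).continuousAt.continuousWithinAt)
    (fun x hx => hd x ⟨hb0.trans hx.1, hx.2.trans hb1'⟩)
  have hdc0 : 0 < d c := by
    rw [hdc]
    have := hmono ⟨hb0, hb1⟩ ⟨hb0', hb1'⟩ hbb'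
    exact div_pos (by linarith) (by linarith)
  have hc0 : r₀ < c := hb0.trans hc.1
  have hc1 : c < 1 := hc.2.trans hb1'
  have hch : 1 / 2 < c := hbh.trans hc.1
  have hdpos : ∀ r ∈ Ico c 1, 0 < d r := by
    intro r hr
    have hdd : ∀ x ∈ Ico c 1, HasDerivAt (fun x => x ^ m * d x) (x ^ m * f (u x)) x := by
      intro x hx
      have hx0 : 0 < x := by linarith [hx.1]
      refine ((hasDerivAt_pow m x).mul (heq x ⟨hc0.trans_le hx.1, hx.2⟩)).congr_deriv ?_
      cases m with
      | zero => simp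
      | succ k => simp only [Nat.add_sub_cancel, pow_succ]; field_simp; ring
    have hmm : MonotoneOn (fun x => x ^ m * d x) (Ico c 1) := by
      apply monotoneOn_of_deriv_nonneg (convex_Ico c 1)
      · exact fun x hx => (hdd x hx).continuousAt.continuousWithinAt
      · intro x hx
        exact (hdd x (interior_subset hx)).differentiableAt.differentiableWithinAt
      · intro x hx
        have hx' := interior_subset hx
        rw [(hdd x hx').deriv]
        have hx0 : 0 < x := by linarith [hx'.1]
        have : 0 ≤ f (u x) := by
          apply hf0
          have := hmono ⟨hb0, hb1⟩ ⟨hc0.trans_le hx'.1, hx'.2⟩ (hc.1.trans_le hx'.1)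
          linarith
        positivity
    have h1 := hmm ⟨le_rfl, hc1⟩ hr hr.1
    simp only at h1
    have h2 : 0 < c ^ m * d c := by
      have : 0 < c := by linarith
      positivity
    have hr0' : 0 < r := by linarith [hr.1]
    exact (pos_iff_pos_of_mul_pos (h2.trans_le h1)).1 (by positivity)
  have hinv : ∀ c' ∈ Ico c 1, ∀ w > u c', ρ w ∈ Ioo c' 1 ∧ u (ρ w) = w := by
    intro c' hc' w hw
    have hc0' := hc0.trans_le hc'.1
    obtain ⟨s, hs0, hs1, hs2, hs3⟩ := hnear w c' hc'.2
    obtain ⟨r, hr, hrw⟩ := intermediate_value_Icc hs1.le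
      (fun x hx => (hd x ⟨hc0'.trans_le hx.1, hx.2.trans_lt hs2⟩).continuousAt.continuousWithinAt)
      (show w ∈ Icc (u c') (u s) from ⟨hw.le, hs3.le⟩)
    have hr' : r ∈ Ioo r₀ 1 := ⟨hc0'.trans_le hr.1, hr.2.trans_lt hs2⟩
    have : ρ w = r := by rw [← hrw]; exact hρ r hr'
    rw [this]
    refine ⟨⟨lt_of_le_of_ne hr.1 ?_, hr'.2⟩, hrw⟩
    rintro rfl
    exact hw.ne' hrw.symm
  have hI := hinv c ⟨le_rfl, hc1⟩
  have hρmono : StrictMonoOn ρ (Ioi (u c)) := by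
    intro w hw w' hw' hlt
    by_contra! h
    obtain ⟨h1, h2⟩ := hI w hw
    obtain ⟨h3, h4⟩ := hI w' hw'
    have := hmono.monotoneOn ⟨hc0.trans h3.1, h3.2⟩ ⟨hc0.trans h1.1, h1.2⟩ h
    linarith
  have hρd : ∀ w > u c, HasDerivAt ρ (d (ρ w))⁻¹ w := by
    intro w hw
    obtain ⟨h1, h2⟩ := hI w hw
    apply HasDerivAt.of_local_left_inverse (f := u)
    · apply hρmono.continuousAt_of_image_mem_nhds (Ioi_mem_nhds hw)
      refine mem_of_superset (Ioo_mem_nhds h1.1 h1.2) ?_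
      intro r hr
      have hr' : r ∈ Ioo r₀ 1 := ⟨hc0.trans hr.1, hr.2⟩
      exact ⟨u r, hmono ⟨hc0, hc1⟩ hr' hr.1, hρ r hr'⟩
    · exact hd _ ⟨hc0.trans h1.1, h1.2⟩
    · exact (hdpos _ ⟨h1.1.le, h1.2⟩).ne'
    · filter_upwards [Ioi_mem_nhds hw] with y hy
      exact (hI y hy).2
  have hgt : ∀ t ≥ u c + 1, t > u c := fun t ht => by linarith
  refine ⟨u c + 1, fun t ht => hρd t (hgt t ht), ?_, ?_, ?_, ?_⟩
  · intro t ht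
    have h1 := (hI t (hgt t ht)).1
    exact hdpos _ ⟨h1.1.le, h1.2⟩
  · intro t ht
    have h1 := (hI t (hgt t ht)).1
    linarith [h1.1]
  · intro t ht
    obtain ⟨h1, h2⟩ := hI t (hgt t ht)
    have hp := hdpos _ ⟨h1.1.le, h1.2⟩
    have hρ0 : 0 < ρ t := by linarith [h1.1]
    have h3 := (heq _ ⟨hc0.trans h1.1, h1.2⟩).comp t (hρd t (hgt t ht))
    have h4 := (hF t).sub ((h3.pow 2).div_const 2)
    refine h4.congr_deriv ?_
    simp only [Function.comp, h2]
    field_simp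
    ring
  · rw [tendsto_order]
    constructor
    · intro x hx
      have hm : max c x ∈ Ico c 1 := ⟨le_max_left _ _, max_lt hc1 hx⟩
      filter_upwards [eventually_gt_atTop (u (max c x))] with w hw
      exact (le_max_right _ _).trans_lt (hinv _ hm w hw).1.1
    · intro x hx
      filter_upwards [eventually_gt_atTop (u c)] with w hw
      exact (hI w hw).1.2.trans hx



theorem statement18 {N : ℕ} (hN : 1 ≤ N) (f : ℝ → ℝ) (hf : ContDiff ℝ 1 f)
    -- condition (2)
    (a : ℝ) (ha : 0 < f a) (hf0 : ∀ t > a, 0 ≤ f t)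
    (F : ℝ → ℝ) (hF : ∀ t, F t = ∫ s in a..t, f s)
    -- condition (3): Keller-Osserman
    (hKO : ∃ T, (∀ t ≥ T, 0 < F t) ∧
      IntegrableOn (fun t => (Real.sqrt (F t))⁻¹) (Ici T))
    (r₀ : ℝ) (hr₀ : r₀ ∈ Ico (0 : ℝ) 1)
    -- u₁, u₂ : (r₀,1) → ℝ strictly increasing C² solutions of
    -- u'' + ((N−1)/r) u' = f(u), blowing up at r = 1 (dᵢ = uᵢ')
    (u₁ u₂ d₁ d₂ : ℝ → ℝ)
    (hmono₁ : StrictMonoOn u₁ (Ioo r₀ 1)) (hmono₂ : StrictMonoOn u₂ (Ioo r₀ 1))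
    (hd₁ : ∀ r ∈ Ioo r₀ (1 : ℝ), HasDerivAt u₁ (d₁ r) r)
    (hd₂ : ∀ r ∈ Ioo r₀ (1 : ℝ), HasDerivAt u₂ (d₂ r) r)
    (heq₁ : ∀ r ∈ Ioo r₀ (1 : ℝ), HasDerivAt d₁ (f (u₁ r) - (N - 1 : ℝ) / r * d₁ r) r)
    (heq₂ : ∀ r ∈ Ioo r₀ (1 : ℝ), HasDerivAt d₂ (f (u₂ r) - (N - 1 : ℝ) / r * d₂ r) r)
    (hblow₁ : Tendsto u₁ (𝓝[<] (1 : ℝ)) atTop)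
    (hblow₂ : Tendsto u₂ (𝓝[<] (1 : ℝ)) atTop)
    -- ρᵢ is the inverse of uᵢ, so that gᵢ(w) = −(dᵢ(ρᵢ(w)))²/2 + F(w) is gᵢ as a
    -- function of the variable u
    (ρ₁ ρ₂ : ℝ → ℝ)
    (hρ₁ : ∀ r ∈ Ioo r₀ (1 : ℝ), ρ₁ (u₁ r) = r)
    (hρ₂ : ∀ r ∈ Ioo r₀ (1 : ℝ), ρ₂ (u₂ r) = r) :
    -- g₁ − g₂ is bounded on a neighborhood of +∞
    ∃ C : ℝ, ∀ᶠ w in atTop,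
      |(-(d₁ (ρ₁ w)) ^ 2 / 2 + F w) - (-(d₂ (ρ₂ w)) ^ 2 / 2 + F w)| ≤ C := by
  obtain ⟨m, rfl⟩ : ∃ m, N = m + 1 := ⟨N - 1, by omega⟩
  have hcast : ((m + 1 : ℕ) : ℝ) - 1 = m := by push_cast; ring
  simp only [hcast] at heq₁ heq₂
  obtain ⟨T, hT, hint⟩ := hKO
  have hFd : ∀ t, HasDerivAt F (f t) t := by
    intro t
    have : F = fun t => ∫ s in a..t, f s := funext hF
    rw [this]
    exact (hf.continuous.integral_hasStrictDerivAt a t).hasDerivAt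
  have hFc : Continuous F := continuous_iff_continuousAt.2 fun t => (hFd t).continuousAt
  obtain ⟨ε, hε, hε0, hεt⟩ := exists_eps hFc hT hint
  have hFt : Tendsto F atTop atTop := tendsto_F (U := a + 1) hT hint fun s t hs hst =>
    mono_of_hd (fun x _ => hFd x) (fun x hx => hf0 x (by linarith)) hs hst
  obtain ⟨U₁, hρd₁, hv₁, hh₁, hg₁, hl₁⟩ := change_var hFd hf0 hr₀ hmono₁ hd₁ heq₁ hblow₁ hρ₁
  obtain ⟨U₂, hρd₂, hv₂, hh₂, hg₂, hl₂⟩ := change_var hFd hf0 hr₀ hmono₂ hd₂ heq₂ hblow₂ hρ₂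
  have hm0 : (0 : ℝ) ≤ m := Nat.cast_nonneg m
  obtain ⟨W, hWa, hWT, hW1, hW2⟩ : ∃ W, a < W ∧ T < W ∧ U₁ ≤ W ∧ U₂ ≤ W :=
    ((eventually_gt_atTop a).and ((eventually_gt_atTop T).and
      ((eventually_ge_atTop U₁).and (eventually_ge_atTop U₂)))).exists
  obtain ⟨K₁, hK₁, hb₁⟩ := v_bounds (U := W) hm0 (fun t _ => hFd t)
    (fun t ht => hf0 t (hWa.trans_le ht)) (fun t ht => hT t (hWT.le.trans ht)) hFt
    (fun t ht => hε t (hWT.trans_le ht)) (fun t ht => hε0 t (hWT.trans_le ht)) hεt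
    (fun t _ => rfl) (fun t ht => hg₁ t (hW1.trans ht)) (fun t ht => hv₁ t (hW1.trans ht))
    (fun t ht => hh₁ t (hW1.trans ht))
  obtain ⟨K₂, hK₂, hb₂⟩ := v_bounds (U := W) hm0 (fun t _ => hFd t)
    (fun t ht => hf0 t (hWa.trans_le ht)) (fun t ht => hT t (hWT.le.trans ht)) hFt
    (fun t ht => hε t (hWT.trans_le ht)) (fun t ht => hε0 t (hWT.trans_le ht)) hεt
    (fun t _ => rfl) (fun t ht => hg₂ t (hW2.trans ht)) (fun t ht => hv₂ t (hW2.trans ht))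
    (fun t ht => hh₂ t (hW2.trans ht))
  obtain ⟨V, hV⟩ := eventually_atTop.1 ((eventually_ge_atTop W).and (hb₁.and hb₂))
  have hWV : ∀ t ≥ V, W ≤ t := fun t ht => (hV t ht).1
  set C : ℝ := 1 + 4 * m * (1 + K₁ + K₂) with hC
  have hC0 : 0 ≤ C := by positivity
  have hpos : ∀ t ≥ V, 0 < F t := fun t ht => hT t (hWT.le.trans (hWV t ht))
  have hdiff : ∀ t ≥ V, |d₁ (ρ₁ t) - d₂ (ρ₂ t)| ≤
      |(F t - d₁ (ρ₁ t) ^ 2 / 2) - (F t - d₂ (ρ₂ t) ^ 2 / 2)| * (Real.sqrt (F t))⁻¹ := by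
    intro t ht
    obtain ⟨-, ⟨h1, -⟩, ⟨h2, -⟩⟩ := hV t ht
    have hq := Real.sqrt_pos.2 (hpos t ht)
    rw [← div_eq_mul_inv, le_div_iff₀ hq]
    have : (F t - d₁ (ρ₁ t) ^ 2 / 2) - (F t - d₂ (ρ₂ t) ^ 2 / 2) =
      -((d₁ (ρ₁ t) - d₂ (ρ₂ t)) * ((d₁ (ρ₁ t) + d₂ (ρ₂ t)) / 2)) := by ring
    rw [this, abs_neg, abs_mul, abs_of_nonneg (a := (d₁ (ρ₁ t) + d₂ (ρ₂ t)) / 2) (by linarith)]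
    gcongr
    linarith
  have main := contraction (U := V) (C := C) (F := F) (f := f) (ε := ε)
    (G := fun t => (F t - d₁ (ρ₁ t) ^ 2 / 2) - (F t - d₂ (ρ₂ t) ^ 2 / 2))
    (D := fun t => ρ₁ t - ρ₂ t)
    (G' := fun t => m * (d₁ (ρ₁ t) / ρ₁ t) - m * (d₂ (ρ₂ t) / ρ₂ t))
    (D' := fun t => (d₁ (ρ₁ t))⁻¹ - (d₂ (ρ₂ t))⁻¹) hC0 hFc (fun t _ => hFd t)
    (fun t ht => hf0 t (hWa.trans_le (hWV t ht))) hpos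
    (fun t ht => hε t (hWT.trans_le (hWV t ht))) (fun t ht => hε0 t (hWT.trans_le (hWV t ht))) hεt
    (fun t ht => (hg₁ t (hW1.trans (hWV t ht))).sub (hg₂ t (hW2.trans (hWV t ht))))
    (fun t ht => (hρd₁ t (hW1.trans (hWV t ht))).sub (hρd₂ t (hW2.trans (hWV t ht))))
    ?_ ?_ ?_ (by simpa using hl₁.sub hl₂)
  · obtain ⟨K, hK⟩ := main
    refine ⟨K, ?_⟩
    filter_upwards [hK] with w hw
    refine le_trans (le_of_eq ?_) hw
    congr 1
    ring
  · intro t ht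
    obtain ⟨-, ⟨h1, h1'⟩, ⟨h2, h2'⟩⟩ := hV t ht
    have hq := Real.sqrt_pos.2 (hpos t ht)
    have hr1 := hh₁ t (hW1.trans (hWV t ht))
    have hr2 := hh₂ t (hW2.trans (hWV t ht))
    set q := Real.sqrt (F t)
    have e1 : d₁ (ρ₁ t) / ρ₁ t ≤ 2 * (K₁ * q) := by
      rw [div_le_iff₀ (by linarith)]
      have : 0 ≤ K₁ * q := by positivity
      nlinarith
    have e2 : d₂ (ρ₂ t) / ρ₂ t ≤ 2 * (K₂ * q) := by
      rw [div_le_iff₀ (by linarith)]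
      have : 0 ≤ K₂ * q := by positivity
      nlinarith
    have e3 : 0 ≤ d₁ (ρ₁ t) / ρ₁ t := div_nonneg (by linarith) (by linarith)
    have e4 : 0 ≤ d₂ (ρ₂ t) / ρ₂ t := div_nonneg (by linarith) (by linarith)
    have e5 := mul_le_mul_of_nonneg_left e1 hm0
    have e6 := mul_le_mul_of_nonneg_left e2 hm0
    have e7 := mul_nonneg hm0 e3
    have e8 := mul_nonneg hm0 e4
    have e9 : C * q = q + 4 * (m * q) + 4 * (m * (K₁ * q)) + 4 * (m * (K₂ * q)) := by
      rw [hC]; ring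
    have p1 : 0 ≤ m * q := by positivity
    have p2 : 0 ≤ m * (K₁ * q) := by positivity
    have p3 : 0 ≤ m * (K₂ * q) := by positivity
    rw [e9, abs_le]
    constructor <;> linarith
  · intro t ht
    obtain ⟨-, ⟨h1, h1'⟩, ⟨h2, h2'⟩⟩ := hV t ht
    have hq := Real.sqrt_pos.2 (hpos t ht)
    have hr1 := hh₁ t (hW1.trans (hWV t ht))
    have hr2 := hh₂ t (hW2.trans (hWV t ht))
    have hdf := hdiff t ht
    set q := Real.sqrt (F t)
    set X := |(F t - d₁ (ρ₁ t) ^ 2 / 2) - (F t - d₂ (ρ₂ t) ^ 2 / 2)| * q⁻¹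
    have hX : 0 ≤ X := (abs_nonneg _).trans hdf
    have p1 : 0 < ρ₁ t := by linarith
    have p2 : 0 < ρ₂ t := by linarith
    have i1 : (ρ₁ t)⁻¹ ≤ 2 := by
      rw [inv_le_comm₀ p1 (by norm_num)]; linarith
    have i2 : (ρ₂ t)⁻¹ ≤ 2 := by
      rw [inv_le_comm₀ p2 (by norm_num)]; linarith
    have e : (m : ℝ) * (d₁ (ρ₁ t) / ρ₁ t) - m * (d₂ (ρ₂ t) / ρ₂ t) =
      m * ((d₁ (ρ₁ t) - d₂ (ρ₂ t)) * (ρ₁ t)⁻¹ -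
        d₂ (ρ₂ t) * (ρ₁ t - ρ₂ t) * ((ρ₁ t)⁻¹ * (ρ₂ t)⁻¹)) := by
      field_simp; ring
    have p3 : 0 ≤ d₂ (ρ₂ t) := by linarith
    have b1 : |(d₁ (ρ₁ t) - d₂ (ρ₂ t)) * (ρ₁ t)⁻¹| ≤ X * 2 := by
      rw [abs_mul, abs_of_nonneg (inv_nonneg.2 p1.le)]
      gcongr
    have b2 : |d₂ (ρ₂ t) * (ρ₁ t - ρ₂ t) * ((ρ₁ t)⁻¹ * (ρ₂ t)⁻¹)| ≤
        K₂ * q * |ρ₁ t - ρ₂ t| * (2 * 2) := by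
      rw [abs_mul, abs_mul, abs_of_nonneg p3, abs_of_nonneg (a := (ρ₁ t)⁻¹ * (ρ₂ t)⁻¹) (by positivity)]
      gcongr
    rw [e, abs_mul, abs_of_nonneg hm0]
    have b3 := abs_sub ((d₁ (ρ₁ t) - d₂ (ρ₂ t)) * (ρ₁ t)⁻¹)
      (d₂ (ρ₂ t) * (ρ₁ t - ρ₂ t) * ((ρ₁ t)⁻¹ * (ρ₂ t)⁻¹))
    set Y := q * |ρ₁ t - ρ₂ t| with hY
    have hY0 : 0 ≤ Y := by positivity
    have b4 : K₂ * q * |ρ₁ t - ρ₂ t| * (2 * 2) = 4 * K₂ * Y := by rw [hY]; ring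
    calc _ ≤ m * (X * 2 + 4 * K₂ * Y) := by gcongr; linarith
      _ ≤ C * (X + Y) := by
        have e9 : C * (X + Y) = m * (X * 2 + 4 * K₂ * Y) + (X + Y + 2 * (m * X) + 4 * (m * Y) +
          4 * (m * K₁ * (X + Y)) + 4 * (m * K₂ * X)) := by rw [hC]; ring
        rw [e9]
        apply le_add_of_nonneg_right
        positivity
  · intro t ht
    obtain ⟨-, ⟨h1, h1'⟩, ⟨h2, h2'⟩⟩ := hV t ht
    have hq := Real.sqrt_pos.2 (hpos t ht)
    have hdf := hdiff t ht
    have hqq := Real.mul_self_sqrt (hpos t ht).le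
    have hFi : (F t)⁻¹ = (Real.sqrt (F t))⁻¹ * (Real.sqrt (F t))⁻¹ := by
      rw [← mul_inv, hqq]
    rw [hFi]
    set q := Real.sqrt (F t)
    set X := |(F t - d₁ (ρ₁ t) ^ 2 / 2) - (F t - d₂ (ρ₂ t) ^ 2 / 2)| * q⁻¹
    have hX : 0 ≤ X := (abs_nonneg _).trans hdf
    have p1 : 0 < d₁ (ρ₁ t) := by linarith
    have p2 : 0 < d₂ (ρ₂ t) := by linarith
    have e : (d₁ (ρ₁ t))⁻¹ - (d₂ (ρ₂ t))⁻¹ =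
      -((d₁ (ρ₁ t) - d₂ (ρ₂ t)) * ((d₁ (ρ₁ t))⁻¹ * (d₂ (ρ₂ t))⁻¹)) := by
      field_simp; ring
    rw [e, abs_neg, abs_mul, abs_of_nonneg (a := (d₁ (ρ₁ t))⁻¹ * (d₂ (ρ₂ t))⁻¹) (by positivity)]
    have hC1 : 1 ≤ C := by
      rw [hC]
      apply le_add_of_nonneg_right
      positivity
    calc _ ≤ X * (q⁻¹ * q⁻¹) := by gcongr
      _ ≤ C * (X * (q⁻¹ * q⁻¹)) := le_mul_of_one_le_left (by positivity) hC1
end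

section
/- Let N ≥ 1, let B be the open unit ball of ℝ^N, and let f ∈ C¹(ℝ) satisfy conditions (2) and (3). Assume there exist a nondecreasing function f̃ : ℝ → ℝ and a constant K such that f(t) = f̃(t) − K t for all t ∈ ℝ. Let u₁ and u₂ be two boundary blow-up solutions of Δu = f(u) in B. Then sup over unit directions θ ∈ S^{N−1} of the radial line integrals ∫_0^1 |f(u₁(rθ)) − f(u₂(rθ))| dr is finite. -/
open MeasureTheory Filter Metric Set Topology

/-- The Euclidean Laplacian: sum of pure second partial derivatives. -/
noncomputable def lap {N : ℕ} (u : EuclideanSpace ℝ (Fin N) → ℝ)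
    (x : EuclideanSpace ℝ (Fin N)) : ℝ :=
  ∑ i, fderiv ℝ (fun y => fderiv ℝ u y (EuclideanSpace.single i 1)) x (EuclideanSpace.single i 1)

/-- A boundary blow-up solution of `Δu = f(u)` on the open unit ball. -/
def IsBlowUp {N : ℕ} (f : ℝ → ℝ) (u : EuclideanSpace ℝ (Fin N) → ℝ) : Prop :=
  ContDiffOn ℝ 2 u (ball 0 1) ∧
  (∀ x ∈ ball (0 : EuclideanSpace ℝ (Fin N)) 1, lap u x = f (u x)) ∧
  ∀ x₀ : EuclideanSpace ℝ (Fin N), ‖x₀‖ = 1 →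
    Tendsto u (𝓝[ball (0 : EuclideanSpace ℝ (Fin N)) 1] x₀) atTop


lemma second_test {φ φ1 : ℝ → ℝ} {x d : ℝ} (h1 : ∀ᶠ t in 𝓝 x, HasDerivAt φ (φ1 t) t)
    (h2 : HasDerivAt φ1 d x) (hmax : IsLocalMax φ x) : d ≤ 0 := by
  by_contra hd
  push Not at hd
  have h0 : φ1 x = 0 := hmax.hasDerivAt_eq_zero h1.self_of_nhds
  have hs := (hasDerivAt_iff_tendsto_slope.1 h2).eventually (eventually_gt_nhds hd)
  have hs' : ∀ᶠ t in 𝓝[>] x, 0 < slope φ1 x t :=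
    hs.filter_mono (nhdsWithin_mono x (fun y hy => ne_of_gt hy))
  have hall : ∀ᶠ t in 𝓝[>] x, 0 < φ1 t ∧ HasDerivAt φ (φ1 t) t ∧ φ t ≤ φ x := by
    filter_upwards [hs', h1.filter_mono nhdsWithin_le_nhds, hmax.filter_mono nhdsWithin_le_nhds,
      self_mem_nhdsWithin] with t ht ht1 ht2 ht3
    refine ⟨?_, ht1, ht2⟩
    rw [slope_def_field, h0, sub_zero] at ht
    have : 0 < t - x := sub_pos.2 ht3
    exact (div_pos_iff_of_pos_right this).1 ht
  obtain ⟨b, hb, hb'⟩ := (mem_nhdsGT_iff_exists_Ioc_subset).1 hall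
  have hxb : x < b := hb
  have hc : ∀ t ∈ Icc x b, HasDerivAt φ (φ1 t) t := by
    intro t ht
    rcases eq_or_lt_of_le ht.1 with h | h
    · rw [← h]; exact h1.self_of_nhds
    · exact (hb' ⟨h, ht.2⟩).2.1
  obtain ⟨c, hc1, hc2⟩ := exists_hasDerivAt_eq_slope φ φ1 hxb
    (fun t ht => (hc t ht).continuousAt.continuousWithinAt)
    (fun t ht => hc t ⟨ht.1.le, ht.2.le⟩)
  have h3 : 0 < φ1 c := (hb' ⟨hc1.1, hc1.2.le⟩).1
  have h4 : φ b ≤ φ x := (hb' ⟨hxb, le_refl _⟩).2.2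
  rw [hc2] at h3
  have : (φ b - φ x) / (b - x) ≤ 0 := div_nonpos_of_nonpos_of_nonneg (by linarith) (by linarith)
  linarith

/-- harmonic radial coordinate -/
noncomputable def hS (n : ℕ) (r : ℝ) : ℝ := ∫ t in (1:ℝ)..r, (t ^ n)⁻¹

lemma hS_one (n : ℕ) : hS n 1 = 0 := by simp [hS]

lemma hS_deriv (n : ℕ) {r : ℝ} (hr : 0 < r) : HasDerivAt (hS n) ((r ^ n)⁻¹) r := by
  have hc : ContinuousOn (fun t : ℝ => (t ^ n)⁻¹) (Ioi 0) := by
    intro t ht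
    have : t ^ n ≠ 0 := pow_ne_zero _ (ne_of_gt ht)
    exact ((continuousAt_id.pow n).inv₀ this).continuousWithinAt
  refine intervalIntegral.integral_hasDerivAt_right ?_ ?_ ?_
  · refine (hc.mono ?_).intervalIntegrable
    intro t ht
    rcases ht with ⟨h, _⟩
    exact lt_of_lt_of_le (lt_min one_pos hr) h
  · exact hc.stronglyMeasurableAtFilter isOpen_Ioi r hr
  · exact hc.continuousAt (Ioi_mem_nhds hr)

lemma hS_strictMono (n : ℕ) : StrictMonoOn (hS n) (Ioi 0) := by
  refine strictMonoOn_of_deriv_pos (convex_Ioi 0)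
    (fun r hr => (hS_deriv n hr).continuousAt.continuousWithinAt) ?_
  intro r hr
  rw [interior_Ioi] at hr
  rw [(hS_deriv n hr).deriv]
  have : 0 < r := hr
  positivity

lemma hS_cont (n : ℕ) : ContinuousOn (hS n) (Ioi 0) :=
  fun _ hr => (hS_deriv n hr).continuousAt.continuousWithinAt

lemma hS_surj (n : ℕ) {r0 r1 s : ℝ} (h0 : 0 < r0) (h01 : r0 ≤ r1) (hs0 : hS n r0 ≤ s)
    (hs1 : s ≤ hS n r1) : ∃ r ∈ Icc r0 r1, hS n r = s := by
  have := intermediate_value_Icc h01 ((hS_cont n).mono (fun t ht => lt_of_lt_of_le h0 ht.1))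
  obtain ⟨r, hr, h⟩ := this ⟨hs0, hs1⟩
  exact ⟨r, hr, h⟩

lemma hS_le {n : ℕ} {r m : ℝ} (hr : 0 < r) (hm : 0 < m) : hS n r ≤ hS n m ↔ r ≤ m :=
  (hS_strictMono n).le_iff_le hr hm

lemma hS_lt {n : ℕ} {r m : ℝ} (hr : 0 < r) (hm : 0 < m) : hS n r < hS n m ↔ r < m :=
  (hS_strictMono n).lt_iff_lt hr hm

/-- `S' ≥ 1` on `(0,1]`. -/
lemma hS_sub_le {n : ℕ} {r m : ℝ} (hr : 0 < r) (hrm : r ≤ m) (hm : m ≤ 1) :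
    m - r ≤ hS n m - hS n r := by
  rcases eq_or_lt_of_le hrm with h | h
  · rw [h]; simp
  obtain ⟨c, hc1, hc2⟩ := exists_hasDerivAt_eq_slope (hS n) (fun r => (r ^ n)⁻¹) h
    ((hS_cont n).mono (fun t ht => lt_of_lt_of_le hr ht.1))
    (fun t ht => hS_deriv n (hr.trans ht.1))
  have hc0 : 0 < c := hr.trans hc1.1
  have : 1 ≤ (c ^ n)⁻¹ := (one_le_inv₀ (by positivity)).2 (pow_le_one₀ hc0.le (hc1.2.le.trans hm))
  rw [hc2, le_div_iff₀ (by linarith)] at this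
  linarith

lemma norm_line_deriv {n : ℕ} (x : EuclideanSpace ℝ (Fin (n+1))) (i : Fin (n+1)) (t : ℝ)
    (h : x + t • EuclideanSpace.single i (1:ℝ) ≠ 0) :
    HasDerivAt (fun τ : ℝ => ‖x + τ • EuclideanSpace.single i (1:ℝ)‖)
      ((x i + t) / ‖x + t • EuclideanSpace.single i (1:ℝ)‖) t := by
  have hq : ∀ τ : ℝ, ‖x + τ • EuclideanSpace.single i (1:ℝ)‖ ^ 2
      = ‖x‖ ^ 2 + 2 * τ * x i + τ ^ 2 := by
    intro τ
    rw [norm_add_sq_real, inner_smul_right, norm_smul]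
    have hi : inner ℝ x (EuclideanSpace.single i (1:ℝ)) = x i := by
      rw [EuclideanSpace.inner_single_right]; simp
    rw [hi]
    simp
    ring
  have h2 : (fun τ : ℝ => ‖x + τ • EuclideanSpace.single i (1:ℝ)‖) =
      fun τ => Real.sqrt (‖x‖ ^ 2 + 2 * τ * x i + τ ^ 2) := by
    funext τ
    rw [← hq, Real.sqrt_sq (norm_nonneg _)]
  have hpos : 0 < ‖x + t • EuclideanSpace.single i (1:ℝ)‖ := norm_pos_iff.2 h
  have hp : HasDerivAt (fun τ : ℝ => ‖x‖ ^ 2 + 2 * τ * x i + τ ^ 2) (2 * x i + 2 * t) t := by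
    have h1 := (((hasDerivAt_id t).const_mul 2).mul_const (x i)).const_add (‖x‖ ^ 2)
    have h3 := h1.add ((hasDerivAt_id t).pow 2)
    refine HasDerivAt.congr_deriv (f := fun τ : ℝ => ‖x‖ ^ 2 + 2 * τ * x i + τ ^ 2) h3 ?_
    simp
  have h4 := hp.sqrt (by rw [← hq]; positivity)
  rw [h2]
  refine h4.congr_deriv ?_
  rw [← hq, Real.sqrt_sq (norm_nonneg _)]
  field_simp

lemma lap_contact {n : ℕ} {u : EuclideanSpace ℝ (Fin (n+1)) → ℝ} {x : EuclideanSpace ℝ (Fin (n+1))}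
    (hx : x ≠ 0) (hu : ContDiffAt ℝ 2 u x) {Q Q1 : ℝ → ℝ} {q2 : ℝ}
    (hQ : ∀ᶠ s in 𝓝 (hS n ‖x‖), HasDerivAt Q (Q1 s) s) (hQ1 : HasDerivAt Q1 q2 (hS n ‖x‖))
    (hmax : IsLocalMax (fun y => u y - Q (hS n ‖y‖)) x) :
    lap u x ≤ q2 / (‖x‖ ^ n) ^ 2 := by
  have hxp : 0 < ‖x‖ := norm_pos_iff.2 hx
  set L : Fin (n+1) → ℝ → EuclideanSpace ℝ (Fin (n+1)) :=
    fun i τ => x + τ • EuclideanSpace.single i (1:ℝ) with hL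
  have hL0 : ∀ i, L i 0 = x := fun i => by simp [hL]
  have hLd : ∀ i τ, HasDerivAt (L i) (EuclideanSpace.single i (1:ℝ)) τ := fun i τ => by
    have := ((hasDerivAt_id τ).smul_const (EuclideanSpace.single i (1:ℝ))).const_add x
    simpa [hL] using this
  have hLt : ∀ i, Tendsto (L i) (𝓝 0) (𝓝 x) := fun i => by
    have := (hLd i 0).continuousAt.tendsto
    rwa [hL0] at this
  have key : ∀ i : Fin (n+1),
      fderiv ℝ (fun y => fderiv ℝ u y (EuclideanSpace.single i 1)) x (EuclideanSpace.single i 1)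
      ≤ q2 * (x i) ^ 2 / (‖x‖ ^ (n+1)) ^ 2 + Q1 (hS n ‖x‖) *
        (1 / ‖x‖ ^ (n+1) - (n + 1) * (x i) ^ 2 / ‖x‖ ^ (n+3)) := by
    intro i
    have hud : ∀ᶠ y in 𝓝 x, DifferentiableAt ℝ u y := by
      filter_upwards [hu.eventually (by simp)] with y hy using hy.differentiableAt (by simp)
    have hu2 : DifferentiableAt ℝ (fun y => fderiv ℝ u y (EuclideanSpace.single i 1)) x := by
      have : ContDiffAt ℝ 1 (fderiv ℝ u) x := hu.fderiv_right (by norm_num)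
      exact (this.differentiableAt (by simp)).clm_apply (differentiableAt_const _)
    have hu1 : ∀ᶠ t in 𝓝 (0:ℝ), HasDerivAt (fun τ => u (L i τ))
        (fderiv ℝ u (L i t) (EuclideanSpace.single i 1)) t := by
      filter_upwards [(hLt i).eventually hud] with t ht
      exact ht.hasFDerivAt.comp_hasDerivAt t (hLd i t)
    have hu2' : HasDerivAt (fun t => fderiv ℝ u (L i t) (EuclideanSpace.single i 1))
        (fderiv ℝ (fun y => fderiv ℝ u y (EuclideanSpace.single i 1)) x
          (EuclideanSpace.single i 1)) 0 := by
      have h := hu2.hasFDerivAt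
      rw [← hL0 i] at h
      have := h.comp_hasDerivAt (0:ℝ) (hLd i 0)
      rw [hL0] at this
      exact this
    have hne : ∀ᶠ y in 𝓝 x, y ≠ 0 := eventually_ne_nhds hx
    have hSt : Tendsto (fun t => hS n ‖L i t‖) (𝓝 0) (𝓝 (hS n ‖x‖)) := by
      have h := (hS_deriv n hxp).continuousAt.tendsto
      exact h.comp ((continuous_norm.tendsto x).comp (hLt i))
    have hSd : ∀ t, L i t ≠ 0 → HasDerivAt (fun τ => hS n ‖L i τ‖)
        ((x i + t) / ‖L i t‖ ^ (n+1)) t := by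
      intro t ht
      have hp : 0 < ‖L i t‖ := norm_pos_iff.2 ht
      have := (hS_deriv n hp).comp t (norm_line_deriv x i t ht)
      refine this.congr_deriv ?_
      change (‖L i t‖ ^ n)⁻¹ * ((x i + t) / ‖L i t‖) = _
      field_simp
      ring
    have hq1 : ∀ᶠ t in 𝓝 (0:ℝ), HasDerivAt (fun τ => Q (hS n ‖L i τ‖))
        (Q1 (hS n ‖L i t‖) * ((x i + t) / ‖L i t‖ ^ (n+1))) t := by
      filter_upwards [(hLt i).eventually hne, hSt.eventually hQ] with t ht ht2
      exact ht2.comp t (hSd t ht)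
    have hq2 : HasDerivAt (fun t => Q1 (hS n ‖L i t‖) * ((x i + t) / ‖L i t‖ ^ (n+1)))
        (q2 * (x i) ^ 2 / (‖x‖ ^ (n+1)) ^ 2 + Q1 (hS n ‖x‖) *
        (1 / ‖x‖ ^ (n+1) - (n + 1) * (x i) ^ 2 / ‖x‖ ^ (n+3))) 0 := by
      have hL0' : L i 0 ≠ 0 := by rw [hL0]; exact hx
      have hb : HasDerivAt (fun t => Q1 (hS n ‖L i t‖)) (q2 * (x i / ‖x‖ ^ (n+1))) 0 := by
        have h := hSd 0 hL0'
        rw [hL0, add_zero] at h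
        have h' := hQ1
        rw [← hL0 i] at h'
        exact h'.comp (0:ℝ) h
      have hc : HasDerivAt (fun t : ℝ => x i + t) 1 0 := (hasDerivAt_id 0).const_add _
      have hd0 : HasDerivAt (fun t => ‖L i t‖) (x i / ‖x‖) 0 := by
        have := norm_line_deriv x i 0 hL0'
        simpa using this
      have hd : HasDerivAt (fun t => ‖L i t‖ ^ (n+1)) ((n+1) * ‖x‖ ^ n * (x i / ‖x‖)) 0 := by
        have := hd0.pow (n+1)
        rw [hL0] at this
        refine HasDerivAt.congr_deriv (f := fun t => ‖L i t‖ ^ (n+1)) this ?_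
        simp
      have := hb.mul (hc.div hd (by rw [hL0]; positivity))
      refine HasDerivAt.congr_deriv
        (f := fun t => Q1 (hS n ‖L i t‖) * ((x i + t) / ‖L i t‖ ^ (n+1))) this ?_
      simp only [Pi.div_apply, hL0]
      field_simp
      ring
    have hm : IsLocalMax (fun t => u (L i t) - Q (hS n ‖L i t‖)) 0 := by
      have := (hLt i).eventually hmax
      filter_upwards [this] with t ht
      simpa [hL0] using ht
    have := second_test (by filter_upwards [hu1, hq1] with t h1 h2 using h1.sub h2)
      (hu2'.sub hq2) hm
    linarith
  have hsum : ∑ i, (x i) ^ 2 = ‖x‖ ^ 2 := by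
    rw [EuclideanSpace.norm_sq_eq]; simp
  calc lap u x ≤ ∑ i : Fin (n+1), (q2 * (x i) ^ 2 / (‖x‖ ^ (n+1)) ^ 2 + Q1 (hS n ‖x‖) *
        (1 / ‖x‖ ^ (n+1) - (n + 1) * (x i) ^ 2 / ‖x‖ ^ (n+3))) := Finset.sum_le_sum fun i _ => key i
    _ = q2 * (∑ i, (x i) ^ 2) / (‖x‖ ^ (n+1)) ^ 2 + Q1 (hS n ‖x‖) *
        ((n + 1) / ‖x‖ ^ (n+1) - (n + 1) * (∑ i, (x i) ^ 2) / ‖x‖ ^ (n+3)) := by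
        rw [Finset.sum_add_distrib, ← Finset.mul_sum, Finset.sum_sub_distrib]
        simp only [← Finset.sum_div, ← Finset.mul_sum]
        simp
    _ = q2 / (‖x‖ ^ n) ^ 2 := by
        rw [hsum]
        field_simp
        ring

lemma psi_bd {K s : ℝ} (hK : 0 ≤ K) (h0 : -(1/(2*(K+1))) ≤ s) (h1 : s ≤ 0) :
    1/2 ≤ 1 - (K+1) * s^2 ∧ 1 - (K+1) * s^2 ≤ 1 := by
  have h2 : -s * (2*(K+1)) ≤ 1 := by
    have : -s ≤ 1/(2*(K+1)) := by linarith
    rwa [le_div_iff₀ (by positivity)] at this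
  have h3 : -s ≤ 1/2 := by nlinarith
  constructor
  · nlinarith
  · nlinarith [sq_nonneg s]

lemma psi_deriv (K μ s : ℝ) : HasDerivAt (fun s => μ * (1 - (K+1) * s^2)) (μ * (-2*(K+1)*s)) s := by
  have := ((((hasDerivAt_id s).pow 2).const_mul (K+1)).const_sub 1).const_mul μ
  refine HasDerivAt.congr_deriv (f := fun s => μ * (1 - (K+1) * s^2)) this ?_
  norm_num
  left
  ring

lemma psi_deriv2 (K μ s : ℝ) : HasDerivAt (fun s => μ * (-2*(K+1)*s)) (μ * (-2*(K+1))) s := by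
  have := ((hasDerivAt_id s).const_mul (-2*(K+1))).const_mul μ
  refine HasDerivAt.congr_deriv (f := fun s => μ * (-2*(K+1)*s)) this ?_
  simp

lemma cmp1D {K : ℝ} (hK : 0 ≤ K) {g : ℝ → ℝ} (hg : ∀ x y, x ≤ y → g x + K * x ≤ g y + K * y)
    {s0 s1 : ℝ} (hs0 : -(1/(2*(K+1))) ≤ s0) (hs1 : s1 ≤ 0)
    {ρ : ℝ → ℝ} (hρ0 : ∀ s, 0 ≤ ρ s) (hρ1 : ∀ s, ρ s ≤ 1)
    {V V1 V2 U U1 U2 : ℝ → ℝ} (hVc : ContinuousOn V (Icc s0 s1)) (hUc : ContinuousOn U (Icc s0 s1))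
    (hV : ∀ s ∈ Ioo s0 s1, HasDerivAt V (V1 s) s) (hV1 : ∀ s ∈ Ioo s0 s1, HasDerivAt V1 (V2 s) s)
    (hU : ∀ s ∈ Ioo s0 s1, HasDerivAt U (U1 s) s) (hU1 : ∀ s ∈ Ioo s0 s1, HasDerivAt U1 (U2 s) s)
    (hV2 : ∀ s ∈ Ioo s0 s1, ρ s * g (V s) ≤ V2 s) (hU2 : ∀ s ∈ Ioo s0 s1, U2 s ≤ ρ s * g (U s))
    (hb0 : V s0 ≤ U s0) (hb1 : V s1 ≤ U s1) : ∀ s ∈ Icc s0 s1, V s ≤ U s := by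
  intro s hs
  by_contra hcon
  push Not at hcon
  have hψ : ∀ s ∈ Icc s0 s1, 1/2 ≤ 1 - (K+1) * s^2 ∧ 1 - (K+1) * s^2 ≤ 1 := fun s hs =>
    psi_bd hK (hs0.trans hs.1) (hs.2.trans hs1)
  obtain ⟨z, hz, hzmax⟩ := isCompact_Icc.exists_isMaxOn ⟨s, hs⟩
    (f := fun s => (V s - U s) / (1 - (K+1) * s^2))
    ((hVc.sub hUc).div (by fun_prop) (fun s hs => by have := (hψ s hs).1; positivity))
  set μ := (V z - U z) / (1 - (K+1) * z^2) with hμ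
  have hμpos : 0 < μ := by
    have h1 : (V s - U s) / (1 - (K+1) * s^2) ≤ μ := hzmax hs
    have h2 : 0 < (V s - U s) / (1 - (K+1) * s^2) :=
      div_pos (by linarith) (by have := (hψ s hs).1; linarith)
    linarith
  have hψz := hψ z hz
  have hVz : V z - U z = μ * (1 - (K+1) * z^2) := by
    rw [hμ, div_mul_cancel₀]; linarith
  have hzpos : U z < V z := by
    have : 0 < μ * (1 - (K+1) * z^2) := mul_pos hμpos (by linarith)
    linarith
  have hzI : z ∈ Ioo s0 s1 := by
    refine ⟨lt_of_le_of_ne hz.1 ?_, lt_of_le_of_ne hz.2 ?_⟩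
    · rintro rfl; linarith
    · rintro rfl; linarith
  have hev : ∀ᶠ t in 𝓝 z, t ∈ Ioo s0 s1 := Ioo_mem_nhds hzI.1 hzI.2
  have hmax : IsLocalMax (fun t => V t - (U t + μ * (1 - (K+1) * t^2))) z := by
    filter_upwards [hev] with t ht
    have ht' : t ∈ Icc s0 s1 := Ioo_subset_Icc_self ht
    have h1 : (V t - U t) / (1 - (K+1) * t^2) ≤ μ := hzmax ht'
    rw [div_le_iff₀ (by have := (hψ t ht').1; linarith)] at h1
    linarith
  have := second_test (φ := fun t => V t - (U t + μ * (1 - (K+1) * t^2)))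
    (φ1 := fun t => V1 t - (U1 t + μ * (-2*(K+1)*t)))
    (by filter_upwards [hev] with t ht using (hV t ht).sub ((hU t ht).add (psi_deriv K μ t)))
    ((hV1 z hzI).sub ((hU1 z hzI).add (psi_deriv2 K μ z))) hmax
  have h1 := hV2 z hzI
  have h2 := hU2 z hzI
  have h3 := hg _ _ hzpos.le
  have h4 : ρ z * (g (U z) - g (V z)) ≤ K * μ := by
    have h5 : g (U z) - g (V z) ≤ K * μ := by
      have : K * (V z - U z) ≤ K * μ := by
        rw [hVz]
        exact mul_le_mul_of_nonneg_left (by nlinarith [hψz.2]) hK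
      linarith
    have h6 : 0 ≤ K * μ := by positivity
    nlinarith [hρ0 z, hρ1 z]
  nlinarith

lemma cmpND {n : ℕ} {K : ℝ} (hK : 0 ≤ K) {g : ℝ → ℝ}
    (hg : ∀ x y, x ≤ y → g x + K * x ≤ g y + K * y)
    {r0 r1 : ℝ} (hr0 : 0 < r0) (hs0 : -(1/(2*(K+1))) ≤ hS n r0) (hr1 : r1 < 1)
    {u : EuclideanSpace ℝ (Fin (n+1)) → ℝ} (hu : ContDiffOn ℝ 2 u (ball 0 1))
    (hlap : ∀ x, r0 ≤ ‖x‖ → ‖x‖ < 1 → g (u x) ≤ lap u x)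
    {U U1 U2 : ℝ → ℝ} (hUc : ContinuousOn U (Icc (hS n r0) (hS n r1)))
    (hU : ∀ s ∈ Ioo (hS n r0) (hS n r1), HasDerivAt U (U1 s) s)
    (hU1 : ∀ s ∈ Ioo (hS n r0) (hS n r1), HasDerivAt U1 (U2 s) s)
    (hU2 : ∀ r ∈ Ioo r0 r1, U2 (hS n r) ≤ (r ^ n) ^ 2 * g (U (hS n r)))
    (hb0 : ∀ x, ‖x‖ = r0 → u x ≤ U (hS n r0)) (hb1 : ∀ x, ‖x‖ = r1 → u x ≤ U (hS n r1)) :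
    ∀ x, r0 ≤ ‖x‖ → ‖x‖ ≤ r1 → u x ≤ U (hS n ‖x‖) := by
  intro x hx0 hx1
  by_contra hcon
  push Not at hcon
  have hmemS : ∀ y : EuclideanSpace ℝ (Fin (n+1)), r0 ≤ ‖y‖ → ‖y‖ ≤ r1 →
      hS n ‖y‖ ∈ Icc (hS n r0) (hS n r1) := fun y h h' =>
    ⟨(hS_le hr0 (by linarith)).2 h, (hS_le (by linarith) (by linarith)).2 h'⟩
  have hS1 : hS n r1 ≤ 0 := by
    rw [← hS_one n]; exact (hS_le (by linarith) one_pos).2 hr1.le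
  have hψ : ∀ y : EuclideanSpace ℝ (Fin (n+1)), r0 ≤ ‖y‖ → ‖y‖ ≤ r1 →
      1/2 ≤ 1 - (K+1) * (hS n ‖y‖)^2 ∧ 1 - (K+1) * (hS n ‖y‖)^2 ≤ 1 := fun y h h' =>
    psi_bd hK (hs0.trans (hmemS y h h').1) ((hmemS y h h').2.trans hS1)
  set A : Set (EuclideanSpace ℝ (Fin (n+1))) := {y | r0 ≤ ‖y‖ ∧ ‖y‖ ≤ r1} with hA
  have hAc : IsCompact A := by
    have hcl : IsClosed A :=
      (isClosed_le continuous_const continuous_norm).inter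
        (isClosed_le continuous_norm continuous_const)
    refine (isCompact_closedBall (0 : EuclideanSpace ℝ (Fin (n+1))) r1).of_isClosed_subset hcl ?_
    intro y hy
    simpa using hy.2
  have hSc : ContinuousOn (fun y : EuclideanSpace ℝ (Fin (n+1)) => hS n ‖y‖) A :=
    (hS_cont n).comp continuous_norm.continuousOn (fun y hy => lt_of_lt_of_le hr0 hy.1)
  have huc : ContinuousOn u A := hu.continuousOn.mono (fun y hy => by
    simpa using lt_of_le_of_lt hy.2 hr1)
  have hUSc : ContinuousOn (fun y : EuclideanSpace ℝ (Fin (n+1)) => U (hS n ‖y‖)) A :=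
    hUc.comp hSc (fun y hy => hmemS y hy.1 hy.2)
  obtain ⟨z, hz, hzmax⟩ := hAc.exists_isMaxOn ⟨x, hx0, hx1⟩
    (f := fun y => (u y - U (hS n ‖y‖)) / (1 - (K+1) * (hS n ‖y‖)^2))
    ((huc.sub hUSc).div (continuousOn_const.sub (continuousOn_const.mul (hSc.pow 2)))
      (fun y hy => by have := (hψ y hy.1 hy.2).1; positivity))
  set μ := (u z - U (hS n ‖z‖)) / (1 - (K+1) * (hS n ‖z‖)^2) with hμ
  have hμpos : 0 < μ := by
    have h1 : (u x - U (hS n ‖x‖)) / (1 - (K+1) * (hS n ‖x‖)^2) ≤ μ := hzmax ⟨hx0, hx1⟩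
    have h2 : 0 < (u x - U (hS n ‖x‖)) / (1 - (K+1) * (hS n ‖x‖)^2) :=
      div_pos (by linarith) (by have := (hψ x hx0 hx1).1; linarith)
    linarith
  have hψz := hψ z hz.1 hz.2
  have hVz : u z - U (hS n ‖z‖) = μ * (1 - (K+1) * (hS n ‖z‖)^2) := by
    rw [hμ, div_mul_cancel₀]; linarith
  have hzpos : U (hS n ‖z‖) < u z := by
    have : 0 < μ * (1 - (K+1) * (hS n ‖z‖)^2) := mul_pos hμpos (by linarith)
    linarith
  have hzI : ‖z‖ ∈ Ioo r0 r1 := by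
    refine ⟨lt_of_le_of_ne hz.1 ?_, lt_of_le_of_ne hz.2 ?_⟩
    · intro h
      have := hb0 z h.symm
      rw [← h] at hzpos; linarith
    · intro h
      have := hb1 z h
      rw [h] at hzpos; linarith
  have hzp : 0 < ‖z‖ := hr0.trans hzI.1
  have hsI : hS n ‖z‖ ∈ Ioo (hS n r0) (hS n r1) :=
    ⟨(hS_lt hr0 hzp).2 hzI.1, (hS_lt hzp (hzp.trans hzI.2)).2 hzI.2⟩
  have hev : ∀ᶠ t in 𝓝 (hS n ‖z‖), t ∈ Ioo (hS n r0) (hS n r1) := Ioo_mem_nhds hsI.1 hsI.2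
  have hevz : ∀ᶠ y in 𝓝 z, ‖y‖ ∈ Ioo r0 r1 :=
    continuous_norm.continuousAt.eventually (Ioo_mem_nhds hzI.1 hzI.2)
  have hmax : IsLocalMax (fun y => u y - (fun t => U t + μ * (1 - (K+1) * t^2)) (hS n ‖y‖)) z := by
    filter_upwards [hevz] with y hy
    have h1 : (u y - U (hS n ‖y‖)) / (1 - (K+1) * (hS n ‖y‖)^2) ≤ μ := hzmax ⟨hy.1.le, hy.2.le⟩
    rw [div_le_iff₀ (by have := (hψ y hy.1.le hy.2.le).1; linarith)] at h1
    linarith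
  have hcd : ContDiffAt ℝ 2 u z := hu.contDiffAt (isOpen_ball.mem_nhds (by
    simpa using hzI.2.trans hr1))
  have := lap_contact (norm_pos_iff.1 hzp) hcd (Q := fun t => U t + μ * (1 - (K+1) * t^2))
    (Q1 := fun t => U1 t + μ * (-2*(K+1)*t))
    (by filter_upwards [hev] with t ht using (hU t ht).add (psi_deriv K μ t))
    ((hU1 _ hsI).add (psi_deriv2 K μ _)) hmax
  have h1 := hlap z hz.1 (hzI.2.trans hr1)
  have h2 := hU2 _ hzI
  have h3 := hg _ _ hzpos.le
  set p := (‖z‖ ^ n) ^ 2 with hp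
  have hp0 : 0 < p := by positivity
  have hp1 : p ≤ 1 := pow_le_one₀ (by positivity) (pow_le_one₀ hzp.le (hzI.2.trans hr1).le)
  have h4 : p * g (u z) ≤ p * g (U (hS n ‖z‖)) + μ * (-2 * (K+1)) := by
    have := h1.trans this
    rw [le_div_iff₀ hp0] at this
    linarith
  have h5 : g (U (hS n ‖z‖)) - g (u z) ≤ K * μ := by
    have : K * (u z - U (hS n ‖z‖)) ≤ K * μ := by
      rw [hVz]
      exact mul_le_mul_of_nonneg_left (by nlinarith [hψz.2]) hK
    linarith
  have h6 : 0 ≤ K * μ := by positivity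
  have h7 : p * (g (U (hS n ‖z‖)) - g (u z)) ≤ K * μ := by nlinarith
  nlinarith

lemma lap_neg' {n : ℕ} (u : EuclideanSpace ℝ (Fin n) → ℝ) (x) :
    lap (fun y => - u y) x = - lap u x := by
  simp only [lap]
  rw [← Finset.sum_neg_distrib]
  refine Finset.sum_congr rfl fun i _ => ?_
  have : (fun y => fderiv ℝ (fun y => - u y) y (EuclideanSpace.single i (1:ℝ))) =
      fun y => - (fderiv ℝ u y (EuclideanSpace.single i 1)) := by
    funext y; rw [fderiv_fun_neg]; rfl
  rw [this, fderiv_fun_neg]; rfl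

lemma cmpND' {n : ℕ} {K : ℝ} (hK : 0 ≤ K) {g : ℝ → ℝ}
    (hg : ∀ x y, x ≤ y → g x + K * x ≤ g y + K * y)
    {r0 r1 : ℝ} (hr0 : 0 < r0) (hs0 : -(1/(2*(K+1))) ≤ hS n r0) (hr1 : r1 < 1)
    {u : EuclideanSpace ℝ (Fin (n+1)) → ℝ} (hu : ContDiffOn ℝ 2 u (ball 0 1))
    (hlap : ∀ x, r0 ≤ ‖x‖ → ‖x‖ < 1 → lap u x ≤ g (u x))
    {U U1 U2 : ℝ → ℝ} (hUc : ContinuousOn U (Icc (hS n r0) (hS n r1)))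
    (hU : ∀ s ∈ Ioo (hS n r0) (hS n r1), HasDerivAt U (U1 s) s)
    (hU1 : ∀ s ∈ Ioo (hS n r0) (hS n r1), HasDerivAt U1 (U2 s) s)
    (hU2 : ∀ r ∈ Ioo r0 r1, (r ^ n) ^ 2 * g (U (hS n r)) ≤ U2 (hS n r))
    (hb0 : ∀ x, ‖x‖ = r0 → U (hS n r0) ≤ u x) (hb1 : ∀ x, ‖x‖ = r1 → U (hS n r1) ≤ u x) :
    ∀ x, r0 ≤ ‖x‖ → ‖x‖ ≤ r1 → U (hS n ‖x‖) ≤ u x := by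
  intro x h0 h1
  have := cmpND (n := n) hK (g := fun t => - g (-t))
    (fun x y h => by have := hg (-y) (-x) (by linarith); linarith) hr0 hs0 hr1
    (u := fun y => - u y) hu.neg
    (fun x h h' => by rw [lap_neg']; simpa using hlap x h h')
    (U := fun s => - U s) (U1 := fun s => - U1 s) (U2 := fun s => - U2 s) hUc.neg
    (fun s hs => (hU s hs).neg) (fun s hs => (hU1 s hs).neg)
    (fun r hr => by have := hU2 r hr; simp only [neg_neg]; linarith)
    (fun x hx => by have := hb0 x hx; linarith) (fun x hx => by have := hb1 x hx; linarith) x h0 h1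
  linarith

lemma mvt_bd {φ φ1 : ℝ → ℝ} {x y c d : ℝ} (hxy : x ≤ y) (hc : ContinuousOn φ (Icc x y))
    (hd : ∀ t ∈ Ioo x y, HasDerivAt φ (φ1 t) t) (h : ∀ t ∈ Ioo x y, c ≤ φ1 t ∧ φ1 t ≤ d) :
    c * (y - x) ≤ φ y - φ x ∧ φ y - φ x ≤ d * (y - x) := by
  rcases eq_or_lt_of_le hxy with h' | h'
  · subst h'; simp
  obtain ⟨z, hz, hz2⟩ := exists_hasDerivAt_eq_slope φ φ1 h' hc hd
  have h3 : φ y - φ x = φ1 z * (y - x) := by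
    rw [hz2, div_mul_cancel₀]; linarith
  rw [h3]
  exact ⟨mul_le_mul_of_nonneg_right (h z hz).1 (by linarith),
    mul_le_mul_of_nonneg_right (h z hz).2 (by linarith)⟩

open scoped NNReal in
lemma bvp0 {g ρ : ℝ → ℝ} {Lg : ℝ≥0} (hgL : LipschitzWith Lg g) {Fm : ℝ} (hg0 : ∀ t, 0 ≤ g t)
    (hgF : ∀ t, g t ≤ Fm) (hρ : Continuous ρ) (hρ0 : ∀ s, 0 ≤ ρ s) (hρ1 : ∀ s, ρ s ≤ 1)
    {s0 s1 : ℝ} (h01 : s0 < s1) (hd : s1 - s0 ≤ 1/2) (A B : ℝ) :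
    ∃ V V1 : ℝ → ℝ, V s0 = A ∧ V s1 = B ∧ ContinuousOn V (Icc s0 s1) ∧
      (∀ s ∈ Ioo s0 s1, HasDerivAt V (V1 s) s) ∧
      (∀ s ∈ Ioo s0 s1, HasDerivAt V1 (ρ s * g (V s)) s) := by
  have hF0 : 0 ≤ Fm := (hg0 0).trans (hgF 0)
  set δ := s1 - s0 with hδ
  have hδ0 : 0 < δ := by simp [hδ, h01]
  set r : ℝ := |B - A| / δ + Fm with hr
  have hr0 : 0 ≤ r := by positivity
  set F : ℝ → ℝ × ℝ → ℝ × ℝ := fun t x => (x.2, ρ t * g x.1) with hFdef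
  set t₀ : Icc s0 s1 := ⟨s0, left_mem_Icc.2 h01.le⟩ with ht0
  have hPL : IsPicardLindelof F t₀ ((A, 0) : ℝ × ℝ) (⟨2 * r + Fm, by positivity⟩ : ℝ≥0)
      (⟨r, hr0⟩ : ℝ≥0) (⟨2 * r + Fm + Fm, by positivity⟩ : ℝ≥0) (max 1 Lg) := by
    refine ⟨?_, ?_, ?_, ?_⟩
    · intro t ht
      apply LipschitzWith.lipschitzOnWith
      refine LipschitzWith.prodMk LipschitzWith.prod_snd ?_
      refine LipschitzWith.of_dist_le_mul fun x y => ?_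
      rw [Real.dist_eq, ← mul_sub, abs_mul, abs_of_nonneg (hρ0 t)]
      have h1 := hgL.dist_le_mul x.1 y.1
      have h2 : dist x.1 y.1 ≤ dist x y := by rw [Prod.dist_eq]; exact le_max_left _ _
      rw [Real.dist_eq] at h1
      calc ρ t * |g x.1 - g y.1| ≤ 1 * |g x.1 - g y.1| :=
            mul_le_mul_of_nonneg_right (hρ1 t) (abs_nonneg _)
        _ ≤ Lg * dist x.1 y.1 := by linarith
        _ ≤ Lg * dist x y := mul_le_mul_of_nonneg_left h2 Lg.2
    · intro x hx
      simp only [hFdef]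
      fun_prop
    · intro t ht x hx
      have h1 : |x.2| ≤ 2 * r + Fm := by
        have h2 : dist x.2 0 ≤ dist x ((A, 0) : ℝ × ℝ) := by
          rw [Prod.dist_eq]; exact le_max_right _ _
        have h3 : dist x ((A, 0) : ℝ × ℝ) ≤ 2 * r + Fm := hx
        rw [Real.dist_eq, sub_zero] at h2
        linarith
      have h4 : |ρ t * g x.1| ≤ Fm := by
        rw [abs_of_nonneg (mul_nonneg (hρ0 t) (hg0 _))]
        nlinarith [hρ0 t, hρ1 t, hg0 x.1, hgF x.1]
      change max |x.2| |ρ t * g x.1| ≤ 2 * r + Fm + Fm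
      exact max_le (by linarith) (by linarith)
    · change (2 * r + Fm + Fm) * max (s1 - s0) (s0 - s0) ≤ 2 * r + Fm - r
      rw [max_eq_left (by linarith)]
      nlinarith
  obtain ⟨α, hα, L', hL'⟩ := hPL.exists_forall_mem_closedBall_eq_hasDerivWithinAt_lipschitzOnWith
  have hmem : ∀ c ∈ Icc (-r) r, ((A, c) : ℝ × ℝ) ∈ closedBall ((A, 0) : ℝ × ℝ) r := by
    intro c hc
    rw [mem_closedBall, Prod.dist_eq]
    simp [Real.dist_eq, abs_le, hc.1, hc.2, hr0]
  have hsol : ∀ c ∈ Icc (-r) r, (α (A, c) s0).1 = A ∧ (α (A, c) s0).2 = c ∧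
      ContinuousOn (fun s => (α (A, c) s).1) (Icc s0 s1) ∧
      ContinuousOn (fun s => (α (A, c) s).2) (Icc s0 s1) ∧
      (∀ s ∈ Ioo s0 s1, HasDerivAt (fun s => (α (A, c) s).1) ((α (A, c) s).2) s) ∧
      (∀ s ∈ Ioo s0 s1, HasDerivAt (fun s => (α (A, c) s).2) (ρ s * g (α (A, c) s).1) s) := by
    intro c hc
    obtain ⟨h1, h2⟩ := hα (A, c) (hmem c hc)
    have h1' : α (A, c) s0 = (A, c) := h1
    have hcont : ContinuousOn (α (A, c)) (Icc s0 s1) := fun s hs => (h2 s hs).continuousWithinAt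
    refine ⟨by rw [h1'], by rw [h1'], continuous_fst.comp_continuousOn hcont,
      continuous_snd.comp_continuousOn hcont, ?_, ?_⟩
    · intro s hs
      have := (h2 s (Ioo_subset_Icc_self hs)).hasDerivAt (Icc_mem_nhds hs.1 hs.2)
      exact this.fst
    · intro s hs
      have := (h2 s (Ioo_subset_Icc_self hs)).hasDerivAt (Icc_mem_nhds hs.1 hs.2)
      exact this.snd
  have hend : ∀ c ∈ Icc (-r) r, A + c * δ ≤ (α (A, c) s1).1 ∧
      (α (A, c) s1).1 ≤ A + (c + Fm * δ) * δ := by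
    intro c hc
    obtain ⟨h1, h2, h3, h4, h5, h6⟩ := hsol c hc
    have hp : ∀ s ∈ Ioo s0 s1, c ≤ (α (A, c) s).2 ∧ (α (A, c) s).2 ≤ c + Fm * δ := by
      intro s hs
      have := mvt_bd (c := 0) (d := Fm) hs.1.le (h4.mono (Icc_subset_Icc le_rfl hs.2.le))
        (fun t ht => h6 t ⟨ht.1, ht.2.trans hs.2⟩)
        (fun t ht => ⟨mul_nonneg (hρ0 t) (hg0 _), by
          nlinarith [hρ0 t, hρ1 t, hg0 (α (A, c) t).1, hgF (α (A, c) t).1]⟩)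
      have hs2 : s - s0 ≤ δ := by have := hs.2; simp only [hδ]; linarith
      have : Fm * (s - s0) ≤ Fm * δ := mul_le_mul_of_nonneg_left hs2 hF0
      constructor <;> linarith
    have := mvt_bd h01.le h3 h5 hp
    constructor <;> linarith
  have hcts : ContinuousOn (fun c => (α (A, c) s1).1) (Icc (-r) r) := by
    have h1 := (hL' s1 (right_mem_Icc.2 h01.le)).continuousOn
    exact continuous_fst.comp_continuousOn (h1.comp (by fun_prop) hmem)
  have hBA : |B - A| / δ * δ = |B - A| := div_mul_cancel₀ _ hδ0.ne'
  have hI := intermediate_value_Icc (by linarith : -r ≤ r) hcts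
  have hB : B ∈ Icc ((α (A, -r) s1).1) ((α (A, r) s1).1) := by
    have e1 := (hend (-r) ⟨le_rfl, by linarith⟩).2
    have e2 := (hend r ⟨by linarith, le_rfl⟩).1
    have e3 := neg_abs_le (B - A)
    have e4 := le_abs_self (B - A)
    constructor
    · have : (-r + Fm * δ) * δ ≤ -|B - A| := by
        have : (-r + Fm * δ) * δ = -(|B - A| / δ * δ) - Fm * (1 - δ) * δ := by rw [hr]; ring
        rw [this, hBA]
        have : 0 ≤ Fm * (1 - δ) * δ := by
          have : 0 ≤ 1 - δ := by linarith
          positivity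
        linarith
      linarith
    · have : |B - A| ≤ r * δ := by
        rw [hr, add_mul, hBA]
        have : 0 ≤ Fm * δ := by positivity
        linarith
      linarith
  obtain ⟨c, hc, hcB⟩ := hI hB
  obtain ⟨h1, h2, h3, h4, h5, h6⟩ := hsol c hc
  exact ⟨_, _, h1, hcB, h3, h5, h6⟩

open scoped NNReal in
lemma bvp {g ρ : ℝ → ℝ} (hgL : ∀ M, ∃ Lg : ℝ≥0, LipschitzOnWith Lg g (Iic M))
    (hgb : ∀ M, ∃ Fm, ∀ t ≤ M, g t ≤ Fm) (hg0 : ∀ t, 0 ≤ g t)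
    (hρ : Continuous ρ) (hρ0 : ∀ s, 0 ≤ ρ s) (hρ1 : ∀ s, ρ s ≤ 1)
    {s0 s1 : ℝ} (h01 : s0 < s1) (hs0 : -(1/2) ≤ s0) (hs1 : s1 ≤ 0) (A B : ℝ) :
    ∃ V V1 : ℝ → ℝ, V s0 = A ∧ V s1 = B ∧ ContinuousOn V (Icc s0 s1) ∧
      (∀ s ∈ Ioo s0 s1, HasDerivAt V (V1 s) s) ∧
      (∀ s ∈ Ioo s0 s1, HasDerivAt V1 (ρ s * g (V s)) s) := by
  set M := max A B
  obtain ⟨Lg, hLg⟩ := hgL M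
  obtain ⟨Fm, hFm⟩ := hgb M
  have hmin : LipschitzWith Lg (fun t => g (min t M)) := by
    have h1 : LipschitzWith 1 (fun t : ℝ => min t M) := LipschitzWith.id.min_const M
    have := hLg.comp (h1.lipschitzOnWith (s := univ)) (fun t _ => min_le_right t M)
    rw [mul_one] at this
    exact lipschitzOnWith_univ.1 this
  obtain ⟨V, V1, h1, h2, h3, h4, h5⟩ := bvp0 hmin (fun t => hg0 _)
    (fun t => hFm _ (min_le_right t M)) hρ hρ0 hρ1 h01 (by linarith) A B
  have hV : ∀ s ∈ Icc s0 s1, V s ≤ M :=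
    cmp1D (K := 0) le_rfl (g := fun _ => 0) (fun x y h => by simp) (by norm_num; linarith) hs1
      hρ0 hρ1 (U := fun _ => M) (U1 := fun _ => 0) (U2 := fun _ => 0) h3 continuousOn_const h4 h5
      (fun s _ => hasDerivAt_const s M) (fun s _ => hasDerivAt_const s 0)
      (fun s _ => by simpa using mul_nonneg (hρ0 s) (hg0 _)) (fun s _ => by simp)
      (by rw [h1]; exact le_max_left _ _) (by rw [h2]; exact le_max_right _ _)
  refine ⟨V, V1, h1, h2, h3, h4, fun s hs => ?_⟩
  have := h5 s hs
  rwa [min_eq_left (hV s (Ioo_subset_Icc_self hs))] at this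

/-- the weight -/
lemma exists_rho (n : ℕ) : ∃ ρ : ℝ → ℝ, Continuous ρ ∧ (∀ s, 0 ≤ ρ s) ∧ (∀ s, ρ s ≤ 1) ∧
    ∀ r ∈ Icc (1/2 : ℝ) 1, ρ (hS n r) = (r ^ n) ^ 2 := by
  have hlt : (1/2 : ℝ) ≤ 1 := by norm_num
  have hS12 : hS n (1/2) ≤ hS n 1 := (hS_le (by norm_num) one_pos).2 hlt
  have hSm : StrictMonoOn (hS n) (Icc (1/2) 1) :=
    (hS_strictMono n).mono (fun t ht => lt_of_lt_of_le (by norm_num) ht.1)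
  have hSc : ContinuousOn (hS n) (Icc (1/2) 1) :=
    (hS_cont n).mono (fun t ht => lt_of_lt_of_le (by norm_num) ht.1)
  let S' : Icc (1/2 : ℝ) 1 → Icc (hS n (1/2)) (hS n 1) := fun r => ⟨hS n r,
    hSm.monotoneOn (left_mem_Icc.2 hlt) r.2 r.2.1, hSm.monotoneOn r.2 (right_mem_Icc.2 hlt) r.2.2⟩
  have hS'c : Continuous S' := by
    refine Continuous.subtype_mk ?_ _
    exact hSc.domRestrict
  have hbij : Function.Bijective S' := by
    constructor
    · intro x y h
      exact Subtype.ext (hSm.injOn x.2 y.2 (congrArg Subtype.val h))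
    · intro y
      obtain ⟨r, hr, h⟩ := hS_surj n (by norm_num) hlt y.2.1 y.2.2
      exact ⟨⟨r, hr⟩, Subtype.ext h⟩
  let e : Icc (1/2 : ℝ) 1 ≃ₜ Icc (hS n (1/2)) (hS n 1) :=
    Continuous.homeoOfEquivCompactToT2 (f := Equiv.ofBijective S' hbij) hS'c
  have he : ∀ r, e r = S' r := fun r => rfl
  refine ⟨fun s => (((e.symm (projIcc _ _ hS12 s)) : ℝ) ^ n) ^ 2, ?_, ?_, ?_, ?_⟩
  · exact ((continuous_subtype_val.comp (e.symm.continuous.comp continuous_projIcc)).pow n).pow 2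
  · intro s
    positivity
  · intro s
    have h := (e.symm (projIcc _ _ hS12 s)).2
    have h0 : (0 : ℝ) ≤ (e.symm (projIcc _ _ hS12 s)) := le_trans (by norm_num) h.1
    exact pow_le_one₀ (pow_nonneg h0 _) (pow_le_one₀ h0 h.2)
  · intro r hr
    have h1 : projIcc _ _ hS12 (hS n r) = e ⟨r, hr⟩ := by
      rw [projIcc_of_mem hS12 (S' ⟨r, hr⟩).2, he]
    simp only [h1, Homeomorph.symm_apply_apply]

structure Setup {n : ℕ} {ι : Type} (g ρ : ℝ → ℝ) (K r0 a : ℝ)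
    (u : ι → EuclideanSpace ℝ (Fin (n+1)) → ℝ) : Prop where
  hK : 0 ≤ K
  hg : ∀ x y, x ≤ y → g x + K * x ≤ g y + K * y
  hgL : ∀ M, ∃ Lg : NNReal, LipschitzOnWith Lg g (Iic M)
  hgb : ∀ M, ∃ Fm, ∀ t ≤ M, g t ≤ Fm
  hg0 : ∀ t, 0 ≤ g t
  hρ : Continuous ρ
  hρ0 : ∀ s, 0 ≤ ρ s
  hρ1 : ∀ s, ρ s ≤ 1
  hρS : ∀ r ∈ Icc (1/2 : ℝ) 1, ρ (hS n r) = (r ^ n) ^ 2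
  hr0 : 1/2 ≤ r0
  hr1 : r0 < 1
  hs1 : -(1/(2*(K+1))) ≤ hS n r0
  hs2 : -(1/(4*((n:ℝ)+1))) ≤ hS n r0
  hu : ∀ i, ContDiffOn ℝ 2 (u i) (ball 0 1)
  hlap : ∀ i x, r0 ≤ ‖x‖ → ‖x‖ < 1 → lap (u i) x = g (u i x)
  hblow : ∀ B, ∃ δ < 1, ∀ i x, δ < ‖x‖ → ‖x‖ < 1 → B ≤ u i x
  hbd : ∀ r < 1, ∃ M, ∀ i x, ‖x‖ ≤ r → |u i x| ≤ M
  hua : ∀ i x, r0 ≤ ‖x‖ → ‖x‖ < 1 → a ≤ u i x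

/-- `V` solves the one-dimensional equation on `[s0,s1]` -/
structure Sol (g ρ : ℝ → ℝ) (s0 s1 : ℝ) (V V1 : ℝ → ℝ) : Prop where
  hc : ContinuousOn V (Icc s0 s1)
  h1 : ∀ s ∈ Ioo s0 s1, HasDerivAt V (V1 s) s
  h2 : ∀ s ∈ Ioo s0 s1, HasDerivAt V1 (ρ s * g (V s)) s

lemma Sol.mono {g ρ : ℝ → ℝ} {s0 s1 t0 t1 : ℝ} {V V1 : ℝ → ℝ} (h : Sol g ρ s0 s1 V V1)
    (h0 : s0 ≤ t0) (h1 : t1 ≤ s1) : Sol g ρ t0 t1 V V1 :=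
  ⟨h.hc.mono (Icc_subset_Icc h0 h1), fun s hs => h.h1 s (Ioo_subset_Ioo h0 h1 hs),
    fun s hs => h.h2 s (Ioo_subset_Ioo h0 h1 hs)⟩

namespace Setup

variable {n : ℕ} {ι : Type} {g ρ : ℝ → ℝ} {K r0 a : ℝ}
    {u : ι → EuclideanSpace ℝ (Fin (n+1)) → ℝ}

lemma r0pos (H : Setup g ρ K r0 a u) : 0 < r0 := lt_of_lt_of_le (by norm_num) H.hr0

lemma s0neg (H : Setup g ρ K r0 a u) : hS n r0 < 0 := by
  rw [← hS_one n]
  exact (hS_lt H.r0pos one_pos).2 H.hr1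

lemma s0q (H : Setup g ρ K r0 a u) : -(1/4) ≤ hS n r0 := by
  refine le_trans ?_ H.hs2
  have : (0:ℝ) ≤ n := Nat.cast_nonneg n
  rw [neg_le_neg_iff, div_le_div_iff₀ (by positivity) (by norm_num)]
  linarith

lemma exS (H : Setup g ρ K r0 a u) {t1 : ℝ} (h1 : hS n r0 < t1) (h2 : t1 ≤ 0) (A B : ℝ) :
    ∃ V V1, V (hS n r0) = A ∧ V t1 = B ∧ Sol g ρ (hS n r0) t1 V V1 := by
  obtain ⟨V, V1, h1, h2, h3, h4, h5⟩ := bvp H.hgL H.hgb H.hg0 H.hρ H.hρ0 H.hρ1 h1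
    (by linarith [H.s0q]) h2 A B
  exact ⟨V, V1, h1, h2, h3, h4, h5⟩

lemma phiIneq (H : Setup g ρ K r0 a u) {s C : ℝ} (hs : s ∈ Icc (hS n r0) 0) (hC : 0 ≤ C) (v : ℝ) :
    ρ s * g v + C * (-2) ≤ ρ s * g (v + C * (-s - s^2)) := by
  have hs0 : s ≤ 0 := hs.2
  have hs1 : -(1/4) ≤ s := H.s0q.trans hs.1
  have hΦ : 0 ≤ -s - s^2 := by nlinarith
  have hΦ1 : K * (-s - s^2) ≤ 2 := by
    have h1 : -(1/(2*(K+1))) ≤ s := le_trans H.hs1 hs.1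
    have hK := H.hK
    have h2 : (2*(K+1)) * (1/(2*(K+1))) = 1 := by field_simp
    nlinarith [mul_nonneg hK (sq_nonneg s)]
  have h := H.hg v (v + C * (-s - s^2)) (by nlinarith)
  have h3 := mul_le_mul_of_nonneg_left h (H.hρ0 s)
  have h4 : ρ s * (K * (C * (-s - s^2))) ≤ C * 2 := by
    calc _ ≤ 1 * (K * (C * (-s - s^2))) :=
          mul_le_mul_of_nonneg_right (H.hρ1 s) (mul_nonneg H.hK (mul_nonneg hC hΦ))
      _ = C * (K * (-s - s^2)) := by ring
      _ ≤ C * 2 := mul_le_mul_of_nonneg_left hΦ1 hC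
  nlinarith

/-- comparison of solutions up to `C Φ` -/
lemma cmpPhi (H : Setup g ρ K r0 a u) {t0 t1 C : ℝ} (ht0 : hS n r0 ≤ t0) (ht1 : t1 ≤ 0)
    (hC : 0 ≤ C) {V V1 U U1 : ℝ → ℝ} (hV : Sol g ρ t0 t1 V V1) (hU : Sol g ρ t0 t1 U U1)
    (hb0 : V t0 ≤ U t0 + C * (-t0 - t0^2)) (hb1 : V t1 ≤ U t1 + C * (-t1 - t1^2)) :
    ∀ s ∈ Icc t0 t1, V s ≤ U s + C * (-s - s^2) := by
  refine cmp1D H.hK H.hg (le_trans H.hs1 ht0) ht1 H.hρ0 H.hρ1 (V := V) (V1 := V1)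
    (V2 := fun s => ρ s * g (V s)) (U := fun s => U s + C * (-s - s^2))
    (U1 := fun s => U1 s + C * (-1 - 2 * s)) (U2 := fun s => ρ s * g (U s) + C * (-2))
    hV.hc ?_ hV.h1 hV.h2 ?_ ?_ (fun s _ => le_rfl) ?_ hb0 hb1
  · exact hU.hc.add (by fun_prop)
  · intro s hs
    refine (hU.h1 s hs).add (HasDerivAt.const_mul C ?_)
    have := ((hasDerivAt_id s).neg).sub (hasDerivAt_pow 2 s)
    exact HasDerivAt.congr_deriv (f := fun s => -s - s^2) this (by simp)
  · intro s hs
    refine (hU.h2 s hs).add (HasDerivAt.const_mul C ?_)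
    have := ((hasDerivAt_id s).const_mul 2).const_sub (-1)
    simpa using this
  · intro s hs
    exact H.phiIneq ⟨ht0.trans hs.1.le, hs.2.le.trans ht1⟩ hC _

lemma cmpS (H : Setup g ρ K r0 a u) {t0 t1 : ℝ} (ht0 : hS n r0 ≤ t0) (ht1 : t1 ≤ 0)
    {V V1 U U1 : ℝ → ℝ} (hV : Sol g ρ t0 t1 V V1) (hU : Sol g ρ t0 t1 U U1)
    (hb0 : V t0 ≤ U t0) (hb1 : V t1 ≤ U t1) :
    ∀ s ∈ Icc t0 t1, V s ≤ U s := by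
  have := H.cmpPhi ht0 ht1 le_rfl hV hU (by simpa using hb0) (by simpa using hb1)
  simpa using this

/-- subsolution property versus affine functions -/
lemma cmpAff (H : Setup g ρ K r0 a u) {t0 t1 : ℝ} (ht0 : hS n r0 ≤ t0) (ht1 : t1 ≤ 0)
    {V V1 : ℝ → ℝ} (hV : Sol g ρ t0 t1 V V1) (p q : ℝ)
    (hb0 : V t0 ≤ p + q * t0) (hb1 : V t1 ≤ p + q * t1) :
    ∀ s ∈ Icc t0 t1, V s ≤ p + q * s := by
  refine cmp1D (K := 0) le_rfl (g := fun _ => 0) (fun x y h => by simp)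
    (by norm_num; linarith [H.s0q]) ht1 H.hρ0 H.hρ1 (V := V) (V1 := V1)
    (V2 := fun s => ρ s * g (V s)) (U := fun s => p + q * s)
    (U1 := fun s => q) (U2 := fun s => 0)
    hV.hc (by fun_prop) hV.h1 hV.h2 ?_ (fun s _ => hasDerivAt_const s q)
    (fun s _ => by simpa using mul_nonneg (H.hρ0 s) (H.hg0 _)) (fun s _ => by simp) hb0 hb1
  intro s hs
  have := ((hasDerivAt_id s).const_mul q).const_add p
  simpa using this

lemma low (H : Setup g ρ K r0 a u) {B : ℝ} (hB : a ≤ B) {V V1 : ℝ → ℝ}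
    (h0 : V (hS n r0) = a) (h1 : V 0 = B) (hV : Sol g ρ (hS n r0) 0 V V1) (i : ι)
    (x : EuclideanSpace ℝ (Fin (n+1))) (hx0 : r0 ≤ ‖x‖) (hx1 : ‖x‖ < 1) :
    V (hS n ‖x‖) ≤ u i x := by
  have hVB : ∀ s ∈ Icc (hS n r0) 0, V s ≤ B := by
    have := H.cmpAff le_rfl le_rfl hV B 0 (by simp [h0, hB]) (by simp [h1])
    simpa using this
  obtain ⟨δ, hδ, hδB⟩ := H.hblow B
  set r1 := (max δ ‖x‖ + 1) / 2
  have hm : max δ ‖x‖ < 1 := max_lt hδ hx1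
  have hr1 : r1 < 1 := by simp only [r1]; linarith
  have hxr : ‖x‖ < r1 := by have := le_max_right δ ‖x‖; simp only [r1]; linarith
  have hδr : δ < r1 := by have := le_max_left δ ‖x‖; simp only [r1]; linarith
  have hrp : 0 < r1 := by linarith [H.r0pos]
  have hS1 : hS n r1 ≤ 0 := by
    rw [← hS_one n]; exact (hS_le hrp one_pos).2 hr1.le
  have hV' := hV.mono le_rfl hS1
  refine cmpND' H.hK H.hg H.r0pos H.hs1 hr1 (H.hu i) (fun x h1 h2 => (H.hlap i x h1 h2).le)
    hV'.hc hV'.h1 hV'.h2 (fun r hr => ?_) (fun y hy => ?_) (fun y hy => ?_) x hx0 hxr.le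
  · rw [H.hρS r ⟨by linarith [hr.1, H.hr0], by linarith [hr.2]⟩]
  · rw [h0]; exact H.hua i y hy.ge (by rw [hy]; exact H.hr1)
  · refine (hVB _ ⟨(hS_le H.r0pos hrp).2 (by linarith), hS1⟩).trans ?_
    exact hδB i y (by rw [hy]; exact hδr) (by rw [hy]; exact hr1)

lemma weight (H : Setup g ρ K r0 a u) {r t : ℝ} (hr : r0 ≤ r) (hr1 : r ≤ 1) (ht : 0 ≤ t)
    (ht1 : t ≤ 1) (hσ : (1-t) * hS n r + t * (1/(4*((n:ℝ)+1))) ≤ 0) :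
    (1-t)^2 * ρ ((1-t) * hS n r + t * (1/(4*((n:ℝ)+1)))) ≤ (r ^ n)^2 := by
  have hrp : 0 < r := H.r0pos.trans_le hr
  have hn : (0:ℝ) ≤ n := Nat.cast_nonneg n
  set c : ℝ := 1/(4*((n:ℝ)+1)) with hc
  have hcn : c * (n + 1) * 4 = 1 := by rw [hc]; field_simp
  have hcp : 0 < c := by positivity
  have hs0 : hS n r ≤ 0 := by
    rw [← hS_one n]; exact (hS_le hrp one_pos).2 hr1
  have hsc : -c ≤ hS n r := H.hs2.trans ((hS_le H.r0pos hrp).2 hr)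
  set σ := (1-t) * hS n r + t * c with hσd
  obtain ⟨m, hm, hmσ⟩ := hS_surj n (s := σ) hrp hr1 (by rw [hσd]; nlinarith)
    (by rw [hS_one]; exact hσ)
  have hmr := hS_sub_le (n := n) hrp hm.1 hm.2
  have hr2 : 1/2 ≤ r := H.hr0.trans hr
  rw [← hmσ, H.hρS m ⟨by linarith [hm.1], hm.2⟩, ← mul_pow]
  have hmp : 0 < m := hrp.trans_le hm.1
  have hd : m - r ≤ 2 * (t * c) := by
    rw [hmσ, hσd] at hmr; nlinarith
  have hb := one_add_mul_le_pow (a := r/m - 1) (by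
    have : 0 ≤ r / m := by positivity
    linarith) n
  have h2 : 1 - t ≤ 1 + n * (r/m - 1) := by
    have h3 : r / m - 1 = -((m - r) / m) := by field_simp; ring
    have h4 : (m - r)/m ≤ 4 * (t * c) := by
      rw [div_le_iff₀ hmp]
      have : 0 ≤ t * c := by positivity
      nlinarith [hm.1]
    rw [h3]
    have h5 : n * ((m-r)/m) ≤ n * (4 * (t*c)) := mul_le_mul_of_nonneg_left h4 hn
    have h6 : n * (4 * (t*c)) = t - 4 * (t * c) := by linear_combination t * hcn
    have : 0 ≤ t * c := by positivity
    linarith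
  have h7 : (1 - t) * m ^ n ≤ r ^ n := by
    have h8 : 1 - t ≤ (r/m)^n := by
      refine h2.trans (hb.trans_eq ?_)
      congr 1; ring
    rw [div_pow, le_div_iff₀ (by positivity)] at h8
    exact h8
  exact pow_le_pow_left₀ (mul_nonneg (by linarith) (by positivity)) h7 2

lemma up (H : Setup g ρ K r0 a u) {B C m0 t R : ℝ} (ht : 0 < t) (ht1 : t < 1) (hR0 : r0 < R)
    (hR1 : R < 1) (hR : (1-t) * hS n R + t * (1/(4*((n:ℝ)+1))) = 0) {V V1 : ℝ → ℝ}
    (hV : Sol g ρ (hS n r0) 0 V V1) (hV0 : V 0 = B) (hm0 : ∀ s ∈ Icc (hS n r0) 0, m0 ≤ V s)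
    (hC : 0 ≤ C) (hCb : ∀ i x, ‖x‖ = r0 → u i x ≤ m0 + C * (-(hS n r0) - (hS n r0)^2))
    (hBu : ∀ i x, ‖x‖ = R → u i x ≤ B) (i : ι) (x : EuclideanSpace ℝ (Fin (n+1)))
    (hx0 : r0 ≤ ‖x‖) (hx1 : ‖x‖ ≤ R) :
    u i x ≤ V ((1-t) * hS n ‖x‖ + t * (1/(4*((n:ℝ)+1))))
      + C * (-(hS n ‖x‖) - (hS n ‖x‖)^2) := by
  have hRp : 0 < R := H.r0pos.trans hR0
  have hSR : hS n R ≤ 0 := by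
    rw [← hS_one n]; exact (hS_le hRp one_pos).2 hR1.le
  set c : ℝ := 1/(4*((n:ℝ)+1)) with hc
  have hcp : 0 < c := by positivity
  have hlo : ∀ s, hS n r0 ≤ s → s ≤ hS n R → hS n r0 ≤ (1-t) * s + t * c := by
    intro s h1 h2
    nlinarith
  have hlo' : ∀ s, hS n r0 < s → s ≤ hS n R → hS n r0 < (1-t) * s + t * c := by
    intro s h1 h2
    nlinarith
  have hhi : ∀ s, s ≤ hS n R → (1-t) * s + t * c ≤ 0 := by
    intro s h2
    nlinarith
  have hhi' : ∀ s, s < hS n R → (1-t) * s + t * c < 0 := by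
    intro s h2
    nlinarith
  have hσd : ∀ s, HasDerivAt (fun s => (1-t) * s + t * c) (1-t) s := by
    intro s
    have := ((hasDerivAt_id s).const_mul (1-t)).add_const (t*c)
    exact HasDerivAt.congr_deriv (f := fun s => (1-t) * s + t * c) this (by simp)
  refine cmpND H.hK H.hg H.r0pos H.hs1 hR1 (H.hu i) (fun x h1 h2 => (H.hlap i x h1 h2).ge)
    (U := fun s => V ((1-t) * s + t * c) + C * (-s - s^2))
    (U1 := fun s => V1 ((1-t) * s + t * c) * (1-t) + C * (-1 - 2 * s))
    (U2 := fun s => (ρ ((1-t) * s + t * c) * g (V ((1-t) * s + t * c))) * (1-t) * (1-t) + C * (-2))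
    ?_ ?_ ?_ ?_ ?_ ?_ x hx0 hx1
  · refine ContinuousOn.add (hV.hc.comp (by fun_prop) ?_) (by fun_prop)
    intro s hs
    exact ⟨hlo s hs.1 hs.2, hhi s hs.2⟩
  · intro s hs
    refine HasDerivAt.add ?_ (HasDerivAt.const_mul C ?_)
    · exact (hV.h1 _ ⟨hlo' s hs.1 hs.2.le, hhi' s hs.2⟩).comp s (hσd s)
    · have := ((hasDerivAt_id s).neg).sub (hasDerivAt_pow 2 s)
      exact HasDerivAt.congr_deriv (f := fun s => -s - s^2) this (by simp)
  · intro s hs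
    refine HasDerivAt.add (HasDerivAt.mul_const ?_ _) (HasDerivAt.const_mul C ?_)
    · exact (hV.h2 _ ⟨hlo' s hs.1 hs.2.le, hhi' s hs.2⟩).comp s (hσd s)
    · have := ((hasDerivAt_id s).const_mul 2).const_sub (-1)
      exact HasDerivAt.congr_deriv (f := fun s => -1 - 2 * s) this (by simp)
  · intro r hr
    have hrp : 0 < r := H.r0pos.trans hr.1
    have hs1 : hS n r0 ≤ hS n r := (hS_le H.r0pos hrp).2 hr.1.le
    have hs2 : hS n r ≤ hS n R := (hS_le hrp hRp).2 hr.2.le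
    have hw := H.weight hr.1.le (by linarith [hr.2]) ht.le ht1.le (hhi _ hs2)
    rw [← hc] at hw
    have hp := H.phiIneq ⟨hs1, hs2.trans hSR⟩ hC (V ((1-t) * hS n r + t * c))
    rw [H.hρS r ⟨by linarith [hr.1, H.hr0], by linarith [hr.2]⟩] at hp
    have := mul_le_mul_of_nonneg_right hw (H.hg0 (V ((1-t) * hS n r + t * c)))
    nlinarith
  · intro y hy
    have := hm0 _ ⟨hlo _ le_rfl ((hS_le H.r0pos hRp).2 hR0.le),
      hhi _ ((hS_le H.r0pos hRp).2 hR0.le)⟩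
    have := hCb i y hy
    linarith
  · intro y hy
    rw [hR, hV0]
    have h1 := hBu i y hy
    have h2 : -(1/4) ≤ hS n R := H.s0q.trans ((hS_le H.r0pos hRp).2 hR0.le)
    have h3 : 0 ≤ C * (-(hS n R) - (hS n R)^2) := mul_nonneg hC (by nlinarith)
    linarith

set_option maxHeartbeats 2000000 in
lemma step2 [Nonempty ι] (H : Setup g ρ K r0 a u) : ∃ C' ≥ 0, ∀ s1 ∈ Ioo (hS n r0) 0,
    ∃ V V1, V (hS n r0) = a ∧ Sol g ρ (hS n r0) 0 V V1 ∧
      (∀ i x, r0 ≤ ‖x‖ → ‖x‖ < 1 → V (hS n ‖x‖) ≤ u i x) ∧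
      (∀ i x, r0 ≤ ‖x‖ → ‖x‖ < 1 → hS n ‖x‖ = s1 → u i x ≤ V s1 + C' * (-s1)) := by
  have hs0 := H.s0neg
  have hs0q := H.s0q
  obtain ⟨Va, Va1, ha0, ha1, hVa⟩ := H.exS H.s0neg le_rfl a a
  obtain ⟨z, hz, hzmin⟩ := isCompact_Icc.exists_isMinOn ⟨0, H.s0neg.le, le_rfl⟩ hVa.hc
  set m0 := Va z with hm0
  obtain ⟨M, hM⟩ := H.hbd r0 H.hr1
  set Φ0 := -(hS n r0) - (hS n r0)^2 with hΦ0
  have hΦp : 0 < Φ0 := by nlinarith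
  set C := max 0 ((M - m0)/Φ0) with hCd
  have hC0 : 0 ≤ C := le_max_left _ _
  have hC1 : M ≤ m0 + C * Φ0 := by
    have := le_max_right 0 ((M - m0)/Φ0)
    rw [div_le_iff₀ hΦp] at this
    linarith
  refine ⟨C + 1, by linarith, fun s1 hs1 => ?_⟩
  have h10 : s1 < 0 := hs1.2
  obtain ⟨rτ, hrτ, hrτS⟩ := hS_surj n (s := s1/2) H.r0pos H.hr1.le (by linarith [hs1.1, hs1.2])
    (by rw [hS_one]; linarith [hs1.2])
  have hrτp : 0 < rτ := H.r0pos.trans_le hrτ.1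
  have hrτ1 : rτ < 1 := by
    rw [← hS_lt (n := n) hrτp one_pos, hS_one, hrτS]; linarith [hs1.2]
  obtain ⟨M', hM'⟩ := H.hbd rτ hrτ1
  set D := max (M' - m0) 0 with hD
  have hD0 : 0 ≤ D := le_max_right _ _
  have hD1 : M' ≤ m0 + D := by linarith [le_max_left (M' - m0) 0]
  set t := min (1/2) (min (-s1) (s1^2/(D+1))) with ht
  have htp : 0 < t := by
    refine lt_min (by norm_num) (lt_min (by linarith) (div_pos (by nlinarith) (by linarith)))
  have ht2 : t ≤ 1/2 := min_le_left _ _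
  have ht3 : t ≤ -s1 := (min_le_right _ _).trans (min_le_left _ _)
  have ht4 : t * (D+1) ≤ s1^2 := by
    have : t ≤ s1^2/(D+1) := (min_le_right _ _).trans (min_le_right _ _)
    rwa [le_div_iff₀ (by linarith)] at this
  have hn : (0:ℝ) ≤ n := Nat.cast_nonneg n
  have hc4 : (1/(4*((n:ℝ)+1))) ≤ 1/4 := by
    rw [div_le_div_iff₀ (by positivity) (by norm_num)]; linarith
  have hcp : 0 < (1/(4*((n:ℝ)+1))) := by positivity
  have hsc := H.hs2
  set c : ℝ := 1/(4*((n:ℝ)+1)) with hc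
  have hs1c : -c < s1 := hsc.trans_lt hs1.1
  have htc : t * c / (1-t) ≤ t/2 := by
    rw [div_le_iff₀ (by linarith)]; nlinarith
  have htc0 : 0 < t * c / (1-t) := div_pos (by positivity) (by linarith)
  obtain ⟨R, hR, hRS⟩ := hS_surj n (s := -(t * c/(1-t))) H.r0pos H.hr1.le
    (by linarith [hs1.1]) (by rw [hS_one]; linarith)
  have hRp : 0 < R := H.r0pos.trans_le hR.1
  have hR1 : R < 1 := by
    rw [← hS_lt (n := n) hRp one_pos, hS_one, hRS]; linarith
  have hR0 : r0 < R := by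
    rw [← hS_lt (n := n) H.r0pos hRp, hRS]; linarith [hs1.1]
  have hReq : (1-t) * hS n R + t * c = 0 := by
    rw [hRS]
    have : (1 - t) ≠ 0 := by linarith
    field_simp
    ring
  obtain ⟨M2, hM2⟩ := H.hbd R hR1
  obtain ⟨V, V1, hV0, hV1, hV⟩ := H.exS H.s0neg le_rfl a (max a M2)
  have hVm : ∀ s ∈ Icc (hS n r0) 0, m0 ≤ V s := fun s hs =>
    (hzmin hs).trans (H.cmpS le_rfl le_rfl hVa hV (by rw [ha0, hV0])
      (by rw [ha1, hV1]; exact le_max_left _ _) s hs)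
  have hlow := H.low (le_max_left a M2) hV0 hV1 hV
  refine ⟨V, V1, hV0, hV, hlow, fun i x hx0 hx1 hxs => ?_⟩
  have hxR : ‖x‖ ≤ R := by
    rw [← hS_le (n := n) (H.r0pos.trans_le hx0) hRp, hxs, hRS]; linarith
  have h1 := H.up htp (by linarith) hR0 hR1 hReq hV hV1 hVm hC0
    (fun i x hx => (le_abs_self _).trans ((hM i x hx.le).trans hC1))
    (fun i x hx => (le_abs_self _).trans ((hM2 i x hx.le).trans (le_max_right _ _))) i x hx0 hxR
  rw [hxs, ← hc] at h1
  have hVτ : V (s1/2) ≤ V s1 + D := by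
    obtain ⟨j⟩ := (inferInstance : Nonempty ι)
    have hnorm : ‖(EuclideanSpace.single 0 rτ : EuclideanSpace ℝ (Fin (n+1)))‖ = rτ := by
      simp [abs_of_pos hrτp]
    have h2 := hlow j (EuclideanSpace.single 0 rτ) (by rw [hnorm]; exact hrτ.1)
      (by rw [hnorm]; exact hrτ1)
    rw [hnorm, hrτS] at h2
    have h3 := (le_abs_self _).trans (hM' j (EuclideanSpace.single 0 rτ) (by rw [hnorm]))
    have h4 := hVm s1 ⟨hs1.1.le, hs1.2.le⟩
    linarith
  set q := D / (s1/2 - s1) with hq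
  have hqd : q * (s1/2 - s1) = D := div_mul_cancel₀ _ (by linarith)
  have hq0 : 0 ≤ q := div_nonneg hD0 (by linarith)
  have hσ1 : (1-t) * s1 + t * c - s1 ≤ t / 2 := by nlinarith
  have h5 := H.cmpAff (t0 := s1) (t1 := s1/2) hs1.1.le (by linarith)
    (hV.mono hs1.1.le (by linarith)) (V s1 - q * s1) q (by linarith) (by linarith)
    ((1-t) * s1 + t * c) ⟨by nlinarith, by linarith⟩
  have h6 : q * ((1-t) * s1 + t * c - s1) ≤ -s1 := by
    have h7 : q * ((1-t) * s1 + t * c - s1) ≤ q * (t/2) := mul_le_mul_of_nonneg_left hσ1 hq0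
    refine h7.trans ?_
    have h8 : q * t * (-s1) ≤ 2 * (s1^2) := by nlinarith
    have h9 : q * t ≤ 2 * (-s1) := by
      by_contra hcon
      push Not at hcon
      nlinarith
    linarith
  have h10 : C * (-s1 - s1^2) ≤ C * (-s1) := mul_le_mul_of_nonneg_left (by nlinarith) hC0
  linarith

end Setup

namespace Setup

variable {n : ℕ} {ι : Type} {g ρ : ℝ → ℝ} {K r0 a : ℝ}
    {u : ι → EuclideanSpace ℝ (Fin (n+1)) → ℝ}

lemma gcont (H : Setup g ρ K r0 a u) : Continuous g := by
  rw [continuous_iff_continuousAt]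
  intro x
  obtain ⟨L, hL⟩ := H.hgL (x+1)
  exact hL.continuousOn.continuousAt (Iic_mem_nhds (by linarith))

lemma step3a [Nonempty ι] (H : Setup g ρ K r0 a u) : ∃ C' ≥ 0, ∃ C'' ≥ 0, ∃ D0 ≥ 0,
    ∀ r1 ∈ Ioo r0 1, ∃ V V1 U U1, Sol g ρ (hS n r0) (hS n r1) V V1 ∧
      Sol g ρ (hS n r0) (hS n r1) U U1 ∧ U (hS n r0) - V (hS n r0) ≤ D0 ∧
      U (hS n r1) - V (hS n r1) ≤ C' * (- hS n r1) ∧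
      (∀ s ∈ Icc (hS n r0) (hS n r1), V s ≤ U s ∧ U s - V s ≤ C'') ∧
      (∀ i x, r0 ≤ ‖x‖ → ‖x‖ ≤ r1 → V (hS n ‖x‖) ≤ u i x ∧ u i x ≤ U (hS n ‖x‖)) := by
  have hs0 := H.s0neg
  have hs0q := H.s0q
  obtain ⟨C', hC', h2⟩ := H.step2
  obtain ⟨M, hM⟩ := H.hbd r0 H.hr1
  set A1 := max a M with hA1
  set Φ0 := -(hS n r0) - (hS n r0)^2 with hΦ0
  have hΦp : 0 < Φ0 := by nlinarith
  have hD0 : 0 ≤ A1 - a := by linarith [le_max_left a M]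
  set C'' := max ((A1 - a)/Φ0) (2*C') with hC''
  have hC''1 : (A1 - a) ≤ C'' * Φ0 := by
    have := le_max_left ((A1 - a)/Φ0) (2*C')
    rwa [div_le_iff₀ hΦp] at this
  have hC''2 : 2 * C' ≤ C'' := le_max_right _ _
  have hC''0 : 0 ≤ C'' := by linarith
  refine ⟨C', hC', C'', hC''0, A1 - a, hD0, fun r1 hr1 => ?_⟩
  have hr1p : 0 < r1 := H.r0pos.trans hr1.1
  have hs01 : hS n r0 < hS n r1 := (hS_lt H.r0pos hr1p).2 hr1.1
  have hs1n : hS n r1 < 0 := by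
    rw [← hS_one n]; exact (hS_lt hr1p one_pos).2 hr1.2
  obtain ⟨V, V1, hV0, hVS', hVlow, hVup⟩ := h2 _ ⟨hs01, hs1n⟩
  have hVS := hVS'.mono le_rfl hs1n.le
  obtain ⟨U, U1, hU0, hU1, hUS⟩ := H.exS hs01 hs1n.le A1 (V (hS n r1) + C' * (-(hS n r1)))
  have hp : 0 ≤ C' * (-(hS n r1)) := mul_nonneg hC' (by linarith)
  have hVU := H.cmpS le_rfl hs1n.le hVS hUS (by rw [hV0, hU0]; linarith) (by rw [hU1]; linarith)
  have hUV := H.cmpPhi le_rfl hs1n.le hC''0 hUS hVS (by rw [hV0, hU0]; linarith) (by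
    rw [hU1]
    have h3 : (-(hS n r1)) * (1/2) ≤ -(hS n r1) - (hS n r1)^2 := by nlinarith
    have h4 := mul_le_mul_of_nonneg_left h3 hC''0
    nlinarith)
  refine ⟨V, V1, U, U1, hVS, hUS, by rw [hV0, hU0], by rw [hU1]; linarith,
    fun s hs => ⟨hVU s hs, ?_⟩, fun i x hx0 hx1 => ⟨hVlow i x hx0 (hx1.trans_lt hr1.2), ?_⟩⟩
  · have h5 := hUV s hs
    have h6 : C'' * (-s - s^2) ≤ C'' * 1 :=
      mul_le_mul_of_nonneg_left (by nlinarith [hs.1, hs.2]) hC''0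
    linarith
  · refine cmpND H.hK H.hg H.r0pos H.hs1 hr1.2 (H.hu i) (fun x h1 h2 => (H.hlap i x h1 h2).ge)
      hUS.hc hUS.h1 hUS.h2 ?_ ?_ ?_ x hx0 hx1
    · intro r hr
      rw [H.hρS r ⟨by linarith [hr.1, H.hr0], by linarith [hr.2, hr1.2]⟩]
    · intro y hy
      rw [hU0]
      exact (le_abs_self _).trans ((hM i y hy.le).trans (le_max_right _ _))
    · intro y hy
      rw [hU1]
      have := hVup i y (by rw [hy]; exact hr1.1.le) (by rw [hy]; exact hr1.2) (by rw [hy])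
      exact this

lemma step3 [Nonempty ι] (H : Setup g ρ K r0 a u) : ∃ rm ∈ Ioo r0 1, ∃ Cst,
    ∀ r' ∈ Ioo rm 1, ∃ J : ℝ → ℝ, ContinuousOn J (Icc rm r') ∧
      (∀ i j x, rm ≤ ‖x‖ → ‖x‖ ≤ r' → |g (u i x) - g (u j x)| ≤ J ‖x‖) ∧
      ∫ r in rm..r', J r ≤ Cst := by
  have hs0 := H.s0neg
  have hs0q := H.s0q
  have hr0p := H.r0pos
  have hK := H.hK
  obtain ⟨C', hC', C'', hC'', D0, hD0, h3⟩ := H.step3a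
  obtain ⟨rm, hrm, hrmS⟩ := hS_surj n (s := hS n r0/2) H.r0pos H.hr1.le (by linarith)
    (by rw [hS_one]; linarith)
  have hrmp : 0 < rm := H.r0pos.trans_le hrm.1
  have hrm1 : rm < 1 := by
    rw [← hS_lt (n := n) hrmp one_pos, hS_one, hrmS]; linarith
  have hrm0 : r0 < rm := by
    rw [← hS_lt (n := n) H.r0pos hrmp, hrmS]; linarith
  refine ⟨rm, ⟨hrm0, hrm1⟩, 2^n * (C' + D0 / (-(hS n r0)/2) + 2 * K * C''), fun r' hr' => ?_⟩
  have hr'p : 0 < r' := hrmp.trans hr'.1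
  have hs'0 : hS n r' < 0 := by
    rw [← hS_one n]; exact (hS_lt hr'p one_pos).2 hr'.2
  have hs'm : hS n r0 / 2 < hS n r' := by
    rw [← hrmS]; exact (hS_lt hrmp hr'p).2 hr'.1
  obtain ⟨r1, hr1, hr1S⟩ := hS_surj n (s := hS n r'/2) hr'p hr'.2.le (by linarith)
    (by rw [hS_one]; linarith)
  have hr1p : 0 < r1 := hr'p.trans_le hr1.1
  have hr11 : r1 < 1 := by
    rw [← hS_lt (n := n) hr1p one_pos, hS_one, hr1S]; linarith
  have hr'1 : r' < r1 := by
    rw [← hS_lt (n := n) hr'p hr1p, hr1S]; linarith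
  obtain ⟨V, V1, U, U1, hV, hU, hW0, hW1, hW, hux⟩ := h3 r1 ⟨by linarith [hr'.1], hr11⟩
  set s0 := hS n r0 with hs0d
  set s1 := hS n r1 with hs1d
  have hWc : ContinuousOn (fun s => U s - V s) (Icc s0 s1) := hU.hc.sub hV.hc
  have hWd : ∀ s ∈ Ioo s0 s1, HasDerivAt (fun s => U s - V s) (U1 s - V1 s) s :=
    fun s hs => (hU.h1 s hs).sub (hV.h1 s hs)
  obtain ⟨η, hη, hηW⟩ := exists_hasDerivAt_eq_slope (fun s => U s - V s) (fun s => U1 s - V1 s)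
    (a := hS n r') (b := s1) (by linarith) (hWc.mono (Icc_subset_Icc (by linarith) le_rfl))
    (fun s hs => hWd s ⟨by linarith [hs.1], hs.2⟩)
  obtain ⟨ξ, hξ, hξW⟩ := exists_hasDerivAt_eq_slope (fun s => U s - V s) (fun s => U1 s - V1 s)
    (a := s0) (b := s0/2) (by linarith) (hWc.mono (Icc_subset_Icc le_rfl (by linarith)))
    (fun s hs => hWd s ⟨hs.1, by linarith [hs.2]⟩)
  have hηb : U1 η - V1 η ≤ C' := by
    rw [hηW, div_le_iff₀ (by linarith)]
    have := (hW (hS n r') ⟨by linarith, by linarith⟩).1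
    have h5 : s1 - hS n r' = - s1 := by linarith
    rw [h5]; linarith
  have hξb : -(D0 / (-s0/2)) ≤ U1 ξ - V1 ξ := by
    rw [hξW, ← neg_div, show s0/2 - s0 = -s0/2 by ring]
    refine div_le_div_of_nonneg_right ?_ (by linarith)
    have := (hW (s0/2) ⟨by linarith, by linarith⟩).1
    linarith
  obtain ⟨rη, hrη, hrηS⟩ := hS_surj n (s := η) hr'p hr'1.le hη.1.le hη.2.le
  obtain ⟨rξ, hrξ, hrξS⟩ := hS_surj n (s := ξ) hr0p hrm0.le hξ.1.le (by rw [hrmS]; exact hξ.2.le)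
  have hrξp : 0 < rξ := hr0p.trans_le hrξ.1
  have hrηp : 0 < rη := hr'p.trans_le hrη.1
  have hrη1 : rη < r1 := by
    rw [← hS_lt (n := n) hrηp hr1p, hrηS]; exact hη.2
  have hrξ0 : r0 < rξ := by
    rw [← hS_lt (n := n) hr0p hrξp, hrξS]; exact hξ.1
  have hSc : ContinuousOn (hS n) (Icc r0 r1) :=
    (hS_cont n).mono (fun t ht => lt_of_lt_of_le hr0p ht.1)
  have hSm : MapsTo (hS n) (Icc r0 r1) (Icc s0 s1) := fun r hr =>
    ⟨(hS_le hr0p (hr0p.trans_le hr.1)).2 hr.1, (hS_le (hr0p.trans_le hr.1) hr1p).2 hr.2⟩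
  have hUc : ContinuousOn (fun r => U (hS n r)) (Icc r0 r1) := hU.hc.comp hSc hSm
  have hVc : ContinuousOn (fun r => V (hS n r)) (Icc r0 r1) := hV.hc.comp hSc hSm
  have hgc := H.gcont
  have hgUc : ContinuousOn (fun r => g (U (hS n r))) (Icc r0 r1) := hgc.comp_continuousOn hUc
  have hgVc : ContinuousOn (fun r => g (V (hS n r))) (Icc r0 r1) := hgc.comp_continuousOn hVc
  set J : ℝ → ℝ := fun r => g (U (hS n r)) - g (V (hS n r)) + 2 * K * (U (hS n r) - V (hS n r))
    with hJ
  have hJc : ContinuousOn J (Icc r0 r1) :=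
    (hgUc.sub hgVc).add (continuousOn_const.mul (hUc.sub hVc))
  have hJ0 : ∀ r ∈ Icc r0 r1, 0 ≤ J r := by
    intro r hr
    have h6 := (hW _ (hSm hr)).1
    have h7 := H.hg _ _ h6
    simp only [hJ]
    nlinarith
  have hsub : Icc rξ rη ⊆ Icc r0 r1 := Icc_subset_Icc hrξ0.le hrη1.le
  have hle : rξ ≤ rη := by linarith [hrξ.2, hrη.1, hr'.1]
  refine ⟨J, hJc.mono (Icc_subset_Icc hrm0.le hr'1.le), ?_, ?_⟩
  · intro i j x hx0 hx1
    obtain ⟨hi1, hi2⟩ := hux i x (hrm0.le.trans hx0) (hx1.trans hr'1.le)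
    obtain ⟨hj1, hj2⟩ := hux j x (hrm0.le.trans hx0) (hx1.trans hr'1.le)
    have g1 := H.hg _ _ hi1
    have g2 := H.hg _ _ hi2
    have g3 := H.hg _ _ hj1
    have g4 := H.hg _ _ hj2
    have k1 := mul_le_mul_of_nonneg_left hi1 hK
    have k2 := mul_le_mul_of_nonneg_left hi2 hK
    have k3 := mul_le_mul_of_nonneg_left hj1 hK
    have k4 := mul_le_mul_of_nonneg_left hj2 hK
    simp only [hJ]
    rw [abs_le]
    constructor <;> linarith
  · have hpc : ContinuousOn (fun r : ℝ => r^n) (Icc r0 r1) := by fun_prop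
    have I1 : ∫ r in rm..r', J r ≤ ∫ r in rξ..rη, J r := by
      refine intervalIntegral.integral_mono_interval hrξ.2 hr'.1.le hrη.1 ?_
        ((hJc.mono (by rw [uIcc_of_le hle]; exact hsub)).intervalIntegrable)
      refine (ae_restrict_iff' measurableSet_Ioc).2 (Eventually.of_forall fun r hr => ?_)
      exact hJ0 r (hsub (Ioc_subset_Icc_self hr))
    have I2 : ∫ r in rξ..rη, J r ≤ ∫ r in rξ..rη, (2^n * (r^n * (g (U (hS n r)) - g (V (hS n r))))
        + 2^n * (2 * K * C'')) := by
      refine intervalIntegral.integral_mono_on hle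
        ((hJc.mono (by rw [uIcc_of_le hle]; exact hsub)).intervalIntegrable)
        (ContinuousOn.intervalIntegrable (ContinuousOn.mono
          ((continuousOn_const.mul (hpc.mul (hgUc.sub hgVc))).add continuousOn_const)
          (by rw [uIcc_of_le hle]; exact hsub))) ?_
      intro r hr
      have hr' := hsub hr
      have hr2 : 1/2 ≤ r := H.hr0.trans hr'.1
      have hr3 : r ≤ 1 := hr'.2.trans hr11.le
      have hp1 : 1 ≤ 2^n * r^n := by
        rw [← mul_pow]; exact one_le_pow₀ (by linarith)
      have hp2 : r^n ≤ 1 := pow_le_one₀ (by linarith) hr3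
      have hp3 : (0:ℝ) < 2^n := by positivity
      have h8 := le_mul_of_one_le_left (hJ0 r hr') hp1
      have h9 := hW _ (hSm hr')
      refine h8.trans ?_
      have h10 : r^n * (U (hS n r) - V (hS n r)) ≤ C'' := by
        refine le_trans (mul_le_of_le_one_left (by linarith) hp2) h9.2
      have h11 := mul_le_mul_of_nonneg_left h10 (show 0 ≤ 2^n * (2 * K) by positivity)
      simp only [hJ]
      nlinarith
    have I3 : ∫ r in rξ..rη, (r^n * (g (U (hS n r)) - g (V (hS n r)))) =
        (U1 η - V1 η) - (U1 ξ - V1 ξ) := by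
      rw [← hrηS, ← hrξS]
      refine intervalIntegral.integral_eq_sub_of_hasDerivAt
        (f := fun r => U1 (hS n r) - V1 (hS n r)) ?_ (ContinuousOn.intervalIntegrable
          ((hpc.mul (hgUc.sub hgVc)).mono (by rw [uIcc_of_le hle]; exact hsub)))
      intro r hr
      rw [uIcc_of_le hle] at hr
      have hr0 : r0 < r := by linarith [hr.1]
      have hr1' : r < r1 := by linarith [hr.2]
      have hrp : 0 < r := hr0p.trans hr0
      have hmem : hS n r ∈ Ioo s0 s1 := ⟨(hS_lt hr0p hrp).2 hr0, (hS_lt hrp hr1p).2 hr1'⟩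
      have hd := ((hU.h2 _ hmem).sub (hV.h2 _ hmem)).comp r (hS_deriv n hrp)
      refine HasDerivAt.congr_deriv (f := fun r => U1 (hS n r) - V1 (hS n r)) hd ?_
      rw [H.hρS r ⟨by linarith [H.hr0], by linarith⟩]
      have : r^n ≠ 0 := by positivity
      field_simp
    refine I1.trans (I2.trans ?_)
    rw [intervalIntegral.integral_add, intervalIntegral.integral_const_mul, I3,
      intervalIntegral.integral_const]
    · have h12 : (rη - rξ) * (2^n * (2 * K * C'')) ≤ 1 * (2^n * (2 * K * C'')) :=
        mul_le_mul_of_nonneg_right (by linarith) (by positivity)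
      have h13 := mul_le_mul_of_nonneg_left (show (U1 η - V1 η) - (U1 ξ - V1 ξ) ≤
        C' + D0 / (-s0/2) by linarith) (show (0:ℝ) ≤ 2^n by positivity)
      rw [smul_eq_mul]
      linarith
    · exact (ContinuousOn.intervalIntegrable (ContinuousOn.mono
          (continuousOn_const.mul (hpc.mul (hgUc.sub hgVc)))
          (by rw [uIcc_of_le hle]; exact hsub)))
    · exact intervalIntegrable_const

end Setup

lemma blow_unif {N : ℕ} {f : ℝ → ℝ} {u : EuclideanSpace ℝ (Fin N) → ℝ} (hu : IsBlowUp f u)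
    (B : ℝ) : ∃ δ < 1, ∀ x, δ < ‖x‖ → ‖x‖ < 1 → B ≤ u x := by
  by_contra hcon
  push Not at hcon
  have hk : ∀ k : ℕ, (1 : ℝ) - 1/((k:ℝ)+1) < 1 := fun k => by
    have : (0:ℝ) < 1/((k:ℝ)+1) := by positivity
    linarith
  choose x hx0 hx1 hxB using fun k : ℕ => hcon _ (hk k)
  have hmem : ∀ k, x k ∈ closedBall (0 : EuclideanSpace ℝ (Fin N)) 1 := fun k => by
    rw [mem_closedBall_zero_iff]; exact (hx1 k).le
  obtain ⟨y, -, φ, hφ, hlim⟩ := (isCompact_closedBall (0 : EuclideanSpace ℝ (Fin N)) 1).tendsto_subseq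
    hmem
  have hn : Tendsto (fun k => ‖x (φ k)‖) atTop (𝓝 ‖y‖) := hlim.norm
  have hn1 : Tendsto (fun k => ‖x k‖) atTop (𝓝 1) := by
    refine tendsto_of_tendsto_of_tendsto_of_le_of_le (g := fun k : ℕ => 1 - 1/((k:ℝ)+1)) ?_
      tendsto_const_nhds (fun k => (hx0 k).le) (fun k => (hx1 k).le)
    simpa using (tendsto_one_div_add_atTop_nhds_zero_nat (𝕜 := ℝ)).const_sub 1
  have hy : ‖y‖ = 1 := tendsto_nhds_unique hn (hn1.comp hφ.tendsto_atTop)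
  have hw : Tendsto (x ∘ φ) atTop (𝓝[ball 0 1] y) :=
    tendsto_nhdsWithin_iff.2 ⟨hlim, Eventually.of_forall fun k => by
      rw [mem_ball_zero_iff]; exact hx1 _⟩
  obtain ⟨k, hk⟩ := (((hu.2.2 y hy).comp hw).eventually_ge_atTop B).exists
  exact absurd (hxB (φ k)) (not_lt.2 hk)

lemma bd_unif {N : ℕ} {u : EuclideanSpace ℝ (Fin N) → ℝ} (hu : ContinuousOn u (ball 0 1))
    (r : ℝ) (hr : r < 1) : ∃ M, ∀ x, ‖x‖ ≤ r → |u x| ≤ M := by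
  obtain ⟨M, hM⟩ := (isCompact_closedBall (0 : EuclideanSpace ℝ (Fin N)) r).exists_bound_of_continuousOn
    (hu.mono (closedBall_subset_ball hr))
  exact ⟨M, fun x hx => hM x (by rwa [mem_closedBall_zero_iff])⟩

lemma g_lip {f : ℝ → ℝ} (hf : ContDiff ℝ 1 f) (a M : ℝ) :
    ∃ Lg : NNReal, LipschitzOnWith Lg (fun t => f (max t a)) (Iic M) := by
  have hlip : ∃ L : NNReal, LipschitzOnWith L f (Icc a (max M a)) := by
    obtain ⟨L, hL⟩ := isCompact_Icc.exists_bound_of_continuousOn (s := Icc a (max M a))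
      ((hf.continuous_deriv le_rfl).continuousOn)
    refine ⟨L.toNNReal, (convex_Icc _ _).lipschitzOnWith_of_nnnorm_deriv_le
      (fun x _ => (hf.differentiable one_ne_zero).differentiableAt) (fun x hx => ?_)⟩
    have := hL x hx
    rw [← NNReal.coe_le_coe, coe_nnnorm]
    exact this.trans (Real.le_coe_toNNReal L)
  obtain ⟨L, hL⟩ := hlip
  refine ⟨L, ?_⟩
  have h1 : LipschitzWith 1 (fun t : ℝ => max t a) := LipschitzWith.id.max_const a
  have := hL.comp (h1.lipschitzOnWith (s := Iic M))
    (fun t ht => ⟨le_max_right t a, max_le_max ht le_rfl⟩)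
  rw [mul_one] at this
  exact this

lemma g_bd {f : ℝ → ℝ} (hf : ContDiff ℝ 1 f) (a M : ℝ) :
    ∃ Fm, ∀ t ≤ M, f (max t a) ≤ Fm := by
  obtain ⟨L, hL⟩ := isCompact_Icc.exists_bound_of_continuousOn (s := Icc a (max M a))
      (hf.continuous.continuousOn)
  exact ⟨L, fun t ht => (le_abs_self _).trans
    (hL _ ⟨le_max_right t a, max_le_max ht le_rfl⟩)⟩

lemma exists_setup {n : ℕ} {f : ℝ → ℝ} (hf : ContDiff ℝ 1 f)
    {a : ℝ} (ha : 0 < f a) (hf0 : ∀ t > a, 0 ≤ f t)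
    {ftil : ℝ → ℝ} {K : ℝ} (hmono : Monotone ftil)
    (hdecomp : ∀ t, f t = ftil t - K * t)
    {u₁ u₂ : EuclideanSpace ℝ (Fin (n+1)) → ℝ}
    (hu₁ : IsBlowUp f u₁) (hu₂ : IsBlowUp f u₂) :
    ∃ ρ r0, Setup (fun t => f (max t a)) ρ |K| r0 a (fun b : Bool => if b then u₁ else u₂) := by
  obtain ⟨ρ, h1, h2, h3, h4⟩ := exists_rho n
  have hge : ∀ t, a ≤ t → 0 ≤ f t := by
    intro t ht
    rcases ht.eq_or_lt with h | h
    · rw [← h]; exact ha.le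
    · exact hf0 t h
  obtain ⟨δ₁, hδ₁, hb₁⟩ := blow_unif hu₁ a
  obtain ⟨δ₂, hδ₂, hb₂⟩ := blow_unif hu₂ a
  have hev : ∀ ε > (0:ℝ), ∀ᶠ r in 𝓝[<] (1:ℝ), -ε ≤ hS n r := by
    intro ε hε
    have hc : Tendsto (hS n) (𝓝[<] 1) (𝓝 0) := by
      rw [← hS_one n]
      exact (hS_deriv n one_pos).continuousAt.tendsto.mono_left nhdsWithin_le_nhds
    exact (hc.eventually_const_lt (by linarith : -ε < 0)).mono fun r hr => hr.le
  have hlt : ∀ c < (1:ℝ), ∀ᶠ r in 𝓝[<] (1:ℝ), c < r ∧ r < 1 := fun c hc =>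
    Ioo_mem_nhdsLT hc
  have hK0 := abs_nonneg K
  obtain ⟨r0, e1, e2, e3, e4, e5⟩ := ((hev (1/(2*(|K|+1))) (by positivity)).and
    ((hev (1/(4*((n:ℝ)+1))) (by positivity)).and ((hlt (1/2) (by norm_num)).and
      ((hlt δ₁ hδ₁).and (hlt δ₂ hδ₂))))).exists
  have hua : ∀ b : Bool, ∀ x, r0 ≤ ‖x‖ → ‖x‖ < 1 → a ≤ (if b then u₁ else u₂) x := by
    intro b x hx0 hx1
    cases b
    · exact hb₂ x (by linarith [e5.1]) hx1
    · exact hb₁ x (by linarith [e4.1]) hx1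
  refine ⟨ρ, r0, ⟨hK0, ?_, g_lip hf a, g_bd hf a, fun t => hge _ (le_max_right _ _), h1, h2, h3, h4,
    e3.1.le, e3.2, e1, e2, ?_, ?_, ?_, ?_, hua⟩⟩
  · intro x y hxy
    have hm := max_le_max hxy (le_refl a)
    have h5 := hmono hm
    have h6 : max y a - max x a ≤ y - x := by
      rcases le_total x a with h | h <;> rcases le_total y a with h' | h' <;>
        simp [h, h'] <;> linarith
    have h7 : K * (max y a - max x a) ≤ |K| * (y - x) :=
      (mul_le_mul_of_nonneg_right (le_abs_self K) (by linarith)).trans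
        (mul_le_mul_of_nonneg_left h6 hK0)
    simp only [hdecomp]
    linarith
  · intro b
    cases b
    · exact hu₂.1
    · exact hu₁.1
  · intro b x hx0 hx1
    have h8 := hua b x hx0 hx1
    have hx : x ∈ ball (0 : EuclideanSpace ℝ (Fin (n+1))) 1 := by rwa [mem_ball_zero_iff]
    simp only [max_eq_left h8]
    cases b
    · exact hu₂.2.1 x hx
    · exact hu₁.2.1 x hx
  · intro B
    obtain ⟨d₁, hd₁, hB₁⟩ := blow_unif hu₁ B
    obtain ⟨d₂, hd₂, hB₂⟩ := blow_unif hu₂ B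
    refine ⟨max d₁ d₂, max_lt hd₁ hd₂, fun b x hx0 hx1 => ?_⟩
    cases b
    · exact hB₂ x (lt_of_le_of_lt (le_max_right _ _) hx0) hx1
    · exact hB₁ x (lt_of_le_of_lt (le_max_left _ _) hx0) hx1
  · intro r hr
    obtain ⟨M₁, hM₁⟩ := bd_unif hu₁.1.continuousOn r hr
    obtain ⟨M₂, hM₂⟩ := bd_unif hu₂.1.continuousOn r hr
    refine ⟨max M₁ M₂, fun b x hx => ?_⟩
    cases b
    · exact (hM₂ x hx).trans (le_max_right _ _)
    · exact (hM₁ x hx).trans (le_max_left _ _)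

/-- passing to the limit in the improper integral -/
lemma improper {h : ℝ → ℝ} (hc : ContinuousOn h (Ico 0 1)) (h0 : ∀ r, 0 ≤ h r) {rm C : ℝ}
    (hrm0 : 0 < rm) (hrm : rm < 1)
    (hC : ∀ r' ∈ Ioo rm 1, ∫ r in (0:ℝ)..r', h r ≤ C) :
    IntegrableOn h (Ioo 0 1) ∧ ∫ r in Ioo (0:ℝ) 1, h r ≤ C := by
  have hint : ∀ r', 0 ≤ r' → r' < 1 → IntegrableOn h (Ioc 0 r') := fun r' h1 h2 =>
    ((hc.mono (fun r hr => ⟨hr.1, hr.2.trans_lt h2⟩)).integrableOn_Icc).mono_set Ioc_subset_Icc_self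
  obtain ⟨b, -, hb, hbt⟩ := exists_seq_strictMono_tendsto' hrm
  have hev : ∀ᶠ k in atTop, ∫ r in (0:ℝ)..(b k), ‖h r‖ ≤ C := Eventually.of_forall fun k => by
    simp only [Real.norm_of_nonneg (h0 _)]
    exact hC _ (hb k)
  have hI : IntegrableOn h (Ioc 0 1) := by
    refine integrableOn_Ioc_of_intervalIntegral_norm_bounded_right (l := atTop) (b := b) (I := C)
      (fun k => hint _ (by linarith [(hb k).1]) (hb k).2) hbt ?_
    filter_upwards [hev] with k hk
    rwa [intervalIntegral.integral_of_le (by linarith [(hb k).1])] at hk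
  refine ⟨hI.mono_set Ioo_subset_Ioc_self, ?_⟩
  rw [← integral_Ioc_eq_integral_Ioo, ← intervalIntegral.integral_of_le zero_le_one]
  have hcont : ContinuousOn (fun x => ∫ r in (0:ℝ)..x, h r) (Icc 0 1) := by
    have hI2 : IntegrableOn h (uIcc 0 1) volume := by
      rw [uIcc_of_le zero_le_one]
      exact (integrableOn_Icc_iff_integrableOn_Ioc (μ := volume)).2 hI
    have := intervalIntegral.continuousOn_primitive_interval (μ := volume) hI2
    rwa [uIcc_of_le zero_le_one] at this
  have ht : Tendsto (fun k => ∫ r in (0:ℝ)..(b k), h r) atTop (𝓝 (∫ r in (0:ℝ)..1, h r)) := by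
    refine (hcont 1 ⟨zero_le_one, le_rfl⟩).tendsto.comp (tendsto_nhdsWithin_iff.2 ⟨hbt, ?_⟩)
    exact Eventually.of_forall fun k => ⟨by linarith [(hb k).1], (hb k).2.le⟩
  exact le_of_tendsto ht (Eventually.of_forall fun k => hC _ (hb k))

theorem statement19 {N : ℕ} (hN : 1 ≤ N) (f : ℝ → ℝ) (hf : ContDiff ℝ 1 f)
    -- condition (2)
    (a : ℝ) (ha : 0 < f a) (hf0 : ∀ t > a, 0 ≤ f t)
    (F : ℝ → ℝ) (hF : ∀ t, F t = ∫ s in a..t, f s)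
    -- condition (3): Keller-Osserman
    (hKO : ∃ T, (∀ t ≥ T, 0 < F t) ∧
      IntegrableOn (fun t => (Real.sqrt (F t))⁻¹) (Ici T))
    -- f is increasing up to a linear perturbation
    (ftil : ℝ → ℝ) (K : ℝ) (hmono : Monotone ftil)
    (hdecomp : ∀ t, f t = ftil t - K * t)
    (u₁ u₂ : EuclideanSpace ℝ (Fin N) → ℝ)
    (hu₁ : IsBlowUp f u₁) (hu₂ : IsBlowUp f u₂) :
    -- sup_{θ ∈ S^{N−1}} ∫_0^1 |f(u₁(rθ)) − f(u₂(rθ))| dr < ∞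
    ∃ C : ℝ, ∀ θ : EuclideanSpace ℝ (Fin N), ‖θ‖ = 1 →
      IntegrableOn (fun r : ℝ => |f (u₁ (r • θ)) - f (u₂ (r • θ))|) (Ioo 0 1) ∧
      ∫ r in Ioo (0 : ℝ) 1, |f (u₁ (r • θ)) - f (u₂ (r • θ))| ≤ C := by
  obtain ⟨n, rfl⟩ : ∃ n, N = n + 1 := ⟨N - 1, by omega⟩
  obtain ⟨ρ, r0, H⟩ := exists_setup hf ha hf0 hmono hdecomp hu₁ hu₂
  obtain ⟨rm, hrm, Cst, hCst⟩ := H.step3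
  have hrmp : 0 < rm := H.r0pos.trans hrm.1
  have hfu : ContinuousOn (fun x => f (u₁ x) - f (u₂ x)) (ball 0 1) :=
    (hf.continuous.comp_continuousOn hu₁.1.continuousOn).sub
      (hf.continuous.comp_continuousOn hu₂.1.continuousOn)
  obtain ⟨M, hM⟩ := bd_unif hfu rm hrm.2
  refine ⟨M * rm + Cst, fun θ hθ => ?_⟩
  have hnorm : ∀ r : ℝ, 0 ≤ r → ‖r • θ‖ = r := fun r hr => by
    rw [norm_smul, hθ, mul_one, Real.norm_of_nonneg hr]
  have hc : ContinuousOn (fun r : ℝ => |f (u₁ (r • θ)) - f (u₂ (r • θ))|) (Ico 0 1) := by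
    have h1 : ContinuousOn (fun r : ℝ => r • θ) (Ico 0 1) := by fun_prop
    refine (hfu.comp h1 (fun r hr => ?_)).abs
    rw [mem_ball_zero_iff, hnorm r hr.1]
    exact hr.2
  refine improper hc (fun r => abs_nonneg _) hrmp hrm.2 (fun r' hr' => ?_)
  obtain ⟨J, hJc, hJ, hJi⟩ := hCst r' hr'
  have hi : ∀ x y : ℝ, 0 ≤ x → x ≤ y → y < 1 →
      IntervalIntegrable (fun r : ℝ => |f (u₁ (r • θ)) - f (u₂ (r • θ))|) volume x y := by
    intro x y h1 h2 h3
    refine ContinuousOn.intervalIntegrable (hc.mono ?_)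
    rw [uIcc_of_le h2]
    exact fun r hr => ⟨h1.trans hr.1, hr.2.trans_lt h3⟩
  rw [← intervalIntegral.integral_add_adjacent_intervals (hi 0 rm le_rfl hrmp.le hrm.2)
    (hi rm r' hrmp.le hr'.1.le hr'.2)]
  refine add_le_add ?_ ?_
  · have h2 : ∫ r in (0:ℝ)..rm, |f (u₁ (r • θ)) - f (u₂ (r • θ))| ≤ ∫ r in (0:ℝ)..rm, M := by
      refine intervalIntegral.integral_mono_on hrmp.le (hi 0 rm le_rfl hrmp.le hrm.2)
        intervalIntegrable_const (fun r hr => ?_)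
      exact hM _ (by rw [hnorm r hr.1]; exact hr.2)
    rw [intervalIntegral.integral_const, smul_eq_mul] at h2
    linarith
  · refine le_trans (intervalIntegral.integral_mono_on hr'.1.le (hi rm r' hrmp.le hr'.1.le hr'.2)
      (ContinuousOn.intervalIntegrable (by rw [uIcc_of_le hr'.1.le]; exact hJc))
      (fun r hr => ?_)) hJi
    have hr0 : 0 ≤ r := hrmp.le.trans hr.1
    have hrn := hnorm r hr0
    have hr1 : r < 1 := hr.2.trans_lt hr'.2
    have h3 : |f (max (u₁ (r • θ)) a) - f (max (u₂ (r • θ)) a)| ≤ J ‖r • θ‖ :=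
      hJ true false (r • θ) (by rw [hrn]; exact hr.1) (by rw [hrn]; exact hr.2)
    have h4 : a ≤ u₁ (r • θ) := H.hua true (r • θ) (by rw [hrn]; exact hrm.1.le.trans hr.1) (by rw [hrn]; exact hr1)
    have h5 : a ≤ u₂ (r • θ) := H.hua false (r • θ) (by rw [hrn]; exact hrm.1.le.trans hr.1) (by rw [hrn]; exact hr1)
    rw [max_eq_left h4, max_eq_left h5, hrn] at h3
    exact h3
end
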